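/- arXiv:2303.04282 — 6 statements merged into one kernel-verified Lean document; each statement's English description precedes it below -/
import Mathlib

section
/- Let D ⊆ ℝ^d be compact and (Ω,𝒜,ℙ) a probability space. Let M : C(D,ℝ) → L²(Ω,ℙ) be a map for which there exist a finite signed Borel measure m on D and a finite signed Borel measure C on D×D such that for all φ, ϕ ∈ C(D,ℝ): E[M(φ)] = ∫_D φ dm and Cov(M(φ), M(ϕ)) = ∫_{D×D} φ(x)ϕ(y) dC(x,y). Then there exists a unique L²(Ω,ℙ)-valued vector measure M̃ on the Borel σ-algebra of D such that for every φ ∈ C(D,ℝ) and every Riemann system of D, the sums Σ_{j∈J_n} φ(x_j^n)·M̃(I_j^n) converge to M(φ) in L²(Ω,ℙ). -/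
open MeasureTheory Filter Topology

/-- A Riemann system of a bounded Borel set `D`: a sequence of finite partitions of `D` into
nonempty Borel pieces with tag points, whose maximal diameter tends to `0`. -/
structure RiemannSystem {α : Type*} [MeasurableSpace α] [PseudoMetricSpace α] (D : Set α) where
  J : ℕ → Finset ℕ
  piece : ℕ → ℕ → Set α
  tag : ℕ → ℕ → α
  measurable : ∀ n, ∀ j ∈ J n, MeasurableSet (piece n j)
  nonempty : ∀ n, ∀ j ∈ J n, (piece n j).Nonempty
  disj : ∀ n, ∀ j ∈ J n, ∀ k ∈ J n, j ≠ k → Disjoint (piece n j) (piece n k)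
  cover : ∀ n, (⋃ j ∈ J n, piece n j) = D
  tag_mem : ∀ n, ∀ j ∈ J n, tag n j ∈ piece n j
  diam_small : ∀ ε : ℝ, 0 < ε → ∃ N : ℕ, ∀ n ≥ N, ∀ j ∈ J n, Metric.diam (piece n j) ≤ ε

/-- An `L²(Ω,P)`-valued vector measure on the Borel subsets of `D` (with value `0` outside
them): it vanishes on `∅` and is countably additive, the series converging in `L²`. -/
structure L2VectorMeasure {α : Type*} [MeasurableSpace α] (D : Set α)
    {Ω : Type*} [MeasurableSpace Ω] (P : Measure Ω) where
  meas : Set α → Lp ℝ 2 P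
  empty' : meas ∅ = 0
  not_measurable' : ∀ s : Set α, ¬ MeasurableSet s → meas s = 0
  not_subset' : ∀ s : Set α, ¬ s ⊆ D → meas s = 0
  countably_additive : ∀ f : ℕ → Set α, (∀ n, MeasurableSet (f n)) → (∀ n, f n ⊆ D) →
    Pairwise (Function.onFun Disjoint f) → HasSum (fun n => meas (f n)) (meas (⋃ n, f n))

/-- Integral of a real function against a finite signed measure, via Jordan decomposition. -/
noncomputable def signedIntegral {α : Type*} [MeasurableSpace α]
    (μ : SignedMeasure α) (f : α → ℝ) : ℝ :=
  ∫ x, f x ∂μ.toJordanDecomposition.posPart - ∫ x, f x ∂μ.toJordanDecomposition.negPart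

open scoped Classical

lemma signedIntegral_add {α : Type*} [MeasurableSpace α] (ν : SignedMeasure α) {f g : α → ℝ}
    (hf : Integrable f ν.totalVariation) (hg : Integrable g ν.totalVariation) :
    signedIntegral ν (fun x => f x + g x) = signedIntegral ν f + signedIntegral ν g := by
  rw [SignedMeasure.totalVariation, integrable_add_measure] at hf hg
  simp only [signedIntegral]
  rw [integral_add hf.1 hg.1, integral_add hf.2 hg.2]
  ring

lemma signedIntegral_const_mul {α : Type*} [MeasurableSpace α] (ν : SignedMeasure α) (c : ℝ)
    (f : α → ℝ) : signedIntegral ν (fun x => c * f x) = c * signedIntegral ν f := by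
  simp only [signedIntegral, integral_const_mul]
  ring

lemma abs_signedIntegral_le {α : Type*} [MeasurableSpace α] (ν : SignedMeasure α) {f : α → ℝ}
    (hf : Integrable f ν.totalVariation) :
    |signedIntegral ν f| ≤ ∫ x, |f x| ∂ν.totalVariation := by
  have hf' := hf
  rw [SignedMeasure.totalVariation, integrable_add_measure] at hf
  rw [SignedMeasure.totalVariation, integral_add_measure hf.1.abs hf.2.abs, signedIntegral]
  exact (abs_sub _ _).trans (add_le_add abs_integral_le_integral_abs abs_integral_le_integral_abs)

instance isFiniteMeasure_totalVariation {α : Type*} [MeasurableSpace α] (ν : SignedMeasure α) :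
    IsFiniteMeasure ν.totalVariation := by
  unfold SignedMeasure.totalVariation
  infer_instance

lemma Continuous.integrable_of_compactSpace {X : Type*} [TopologicalSpace X] [CompactSpace X]
    [MeasurableSpace X] [OpensMeasurableSpace X] {f : X → ℝ} (hf : Continuous f)
    (μ : Measure X) [IsFiniteMeasure μ] : Integrable f μ :=
  hf.integrable_of_hasCompactSupport (HasCompactSupport.of_compactSpace f)

lemma sq_integral_abs_le {α : Type*} [MeasurableSpace α] (μ : Measure α) [IsFiniteMeasure μ]
    {f : α → ℝ} (hf : MemLp f 2 μ) :
    (∫ x, |f x| ∂μ) ^ 2 ≤ μ.real Set.univ * ∫ x, f x ^ 2 ∂μ := by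
  have h := integral_mul_le_Lp_mul_Lq_of_nonneg (μ := μ) (p := 2) (q := 2)
    (Real.HolderConjugate.two_two) (f := fun _ => (1 : ℝ)) (g := fun x => |f x|)
    (ae_of_all _ fun _ => zero_le_one) (ae_of_all _ fun _ => abs_nonneg _)
    (memLp_const _) (by simpa using hf.norm)
  simp only [one_mul, integral_const, smul_eq_mul, Real.rpow_two, sq_abs, one_pow, mul_one,
    ← Real.sqrt_eq_rpow] at h
  have h0 : 0 ≤ ∫ x, |f x| ∂μ := integral_nonneg fun _ => abs_nonneg _
  have h1 : 0 ≤ ∫ x, f x ^ 2 ∂μ := integral_nonneg fun _ => sq_nonneg _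
  calc _ ≤ (√(μ.real Set.univ) * √(∫ x, f x ^ 2 ∂μ)) ^ 2 := by gcongr
    _ = _ := by rw [mul_pow, Real.sq_sqrt measureReal_nonneg, Real.sq_sqrt h1]

lemma isLinearMap_of_inner_eq {X : Type*} [TopologicalSpace X] [CompactSpace X]
    [SecondCountableTopology X] [MeasurableSpace X] [BorelSpace X] {H : Type*}
    [NormedAddCommGroup H] [InnerProductSpace ℝ H] {M : C(X, ℝ) → H} {m : SignedMeasure X}
    {C : SignedMeasure (X × X)}
    (hM : ∀ φ ψ : C(X, ℝ), inner ℝ (M φ) (M ψ) =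
      signedIntegral C (fun q => φ q.1 * ψ q.2) + signedIntegral m φ * signedIntegral m ψ) :
    IsLinearMap ℝ M := by
  have hi : ∀ φ ψ : C(X, ℝ), Integrable (fun q : X × X => φ q.1 * ψ q.2) C.totalVariation :=
    fun φ ψ => Continuous.integrable_of_compactSpace (by fun_prop) _
  have hi' : ∀ φ : C(X, ℝ), Integrable φ m.totalVariation :=
    fun φ => φ.continuous.integrable_of_compactSpace _
  have hadd : ∀ φ ψ χ : C(X, ℝ), inner ℝ (M (φ + ψ)) (M χ) = inner ℝ (M φ + M ψ) (M χ) := by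
    intro φ ψ χ
    rw [inner_add_left, hM, hM, hM]
    have h1 := signedIntegral_add C (hi φ χ) (hi ψ χ)
    have h2 := signedIntegral_add m (hi' φ) (hi' ψ)
    simp only [ContinuousMap.add_apply, ContinuousMap.coe_add, add_mul] at h1 ⊢
    rw [h1, show (⇑φ + ⇑ψ) = fun x => φ x + ψ x from rfl, h2]
    ring
  have hsmul : ∀ (c : ℝ) (φ χ : C(X, ℝ)), inner ℝ (M (c • φ)) (M χ) = inner ℝ (c • M φ) (M χ) := by
    intro c φ χ
    rw [real_inner_smul_left, hM, hM]
    have h1 := signedIntegral_const_mul C c (fun q => φ q.1 * χ q.2)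
    have h2 := signedIntegral_const_mul m c φ
    simp only [ContinuousMap.smul_apply, ContinuousMap.coe_smul, smul_eq_mul, mul_assoc]
    rw [h1, show (c • ⇑φ) = fun x => c * φ x from rfl, h2]
    ring
  constructor
  · intro φ ψ
    rw [← sub_eq_zero, ← inner_self_eq_zero (𝕜 := ℝ), inner_sub_right, inner_add_right]
    simp only [inner_sub_left, hadd, sub_self, add_zero]
  · intro c φ
    rw [← sub_eq_zero, ← inner_self_eq_zero (𝕜 := ℝ), inner_sub_right, inner_smul_right]
    simp only [inner_sub_left, hsmul, sub_self, mul_zero]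

lemma signedIntegral_mul_self_add_sq_le {X : Type*} [TopologicalSpace X] [CompactSpace X]
    [SecondCountableTopology X] [MeasurableSpace X] [BorelSpace X] (m : SignedMeasure X)
    (C : SignedMeasure (X × X)) (φ : C(X, ℝ)) :
    signedIntegral C (fun q => φ q.1 * φ q.2) + signedIntegral m φ * signedIntegral m φ ≤
      (1 + m.totalVariation.real Set.univ) * ∫ x, φ x ^ 2
        ∂(C.totalVariation.fst + C.totalVariation.snd + m.totalVariation) := by
  have hsq : ∀ (ν : Measure X) [IsFiniteMeasure ν], Integrable (fun x => φ x ^ 2) ν :=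
    fun ν _ => Continuous.integrable_of_compactSpace (by fun_prop) _
  have hi : Integrable (fun q : X × X => φ q.1 * φ q.2) C.totalVariation :=
    Continuous.integrable_of_compactSpace (by fun_prop) _
  have hfst : ∫ x, φ x ^ 2 ∂C.totalVariation.fst = ∫ q, φ q.1 ^ 2 ∂C.totalVariation :=
    integral_map (by fun_prop) (Continuous.aestronglyMeasurable (by fun_prop))
  have hsnd : ∫ x, φ x ^ 2 ∂C.totalVariation.snd = ∫ q, φ q.2 ^ 2 ∂C.totalVariation :=
    integral_map (by fun_prop) (Continuous.aestronglyMeasurable (by fun_prop))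
  have h1 : signedIntegral C (fun q => φ q.1 * φ q.2) ≤
      ∫ q, φ q.1 ^ 2 ∂C.totalVariation + ∫ q, φ q.2 ^ 2 ∂C.totalVariation := by
    have i1 : Integrable (fun q : X × X => φ q.1 ^ 2) C.totalVariation :=
      Continuous.integrable_of_compactSpace (by fun_prop) _
    have i2 : Integrable (fun q : X × X => φ q.2 ^ 2) C.totalVariation :=
      Continuous.integrable_of_compactSpace (by fun_prop) _
    rw [← integral_add i1 i2]
    refine (le_abs_self _).trans ((abs_signedIntegral_le C hi).trans ?_)
    refine integral_mono hi.abs (i1.add i2) fun q => ?_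
    simp only [abs_le]
    constructor <;> nlinarith [sq_nonneg (φ q.1 + φ q.2), sq_nonneg (φ q.1 - φ q.2)]
  have h2 : signedIntegral m φ * signedIntegral m φ ≤
      m.totalVariation.real Set.univ * ∫ x, φ x ^ 2 ∂m.totalVariation := by
    have hL : MemLp φ 2 m.totalVariation :=
      (memLp_two_iff_integrable_sq φ.continuous.aestronglyMeasurable).2 (hsq _)
    refine le_trans ?_ (sq_integral_abs_le _ hL)
    rw [← sq, ← sq_abs]
    gcongr
    exact abs_signedIntegral_le m (φ.continuous.integrable_of_compactSpace _)
  have p1 : 0 ≤ ∫ q, φ q.1 ^ 2 ∂C.totalVariation := integral_nonneg fun _ => sq_nonneg _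
  have p2 : 0 ≤ ∫ q, φ q.2 ^ 2 ∂C.totalVariation := integral_nonneg fun _ => sq_nonneg _
  have p3 : 0 ≤ ∫ x, φ x ^ 2 ∂m.totalVariation := integral_nonneg fun _ => sq_nonneg _
  have p4 : 0 ≤ m.totalVariation.real Set.univ := measureReal_nonneg
  rw [integral_add_measure (hsq _) (hsq _), integral_add_measure (hsq _) (hsq _), hfst, hsnd]
  nlinarith [mul_nonneg p4 p1, mul_nonneg p4 p2]

lemma norm_sq_continuousMap_toLp {X : Type*} [TopologicalSpace X] [CompactSpace X]
    [SecondCountableTopology X] [MeasurableSpace X] [BorelSpace X] (μ : Measure X)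
    [IsFiniteMeasure μ] (φ : C(X, ℝ)) :
    ‖ContinuousMap.toLp 2 μ ℝ φ‖ ^ 2 = ∫ x, φ x ^ 2 ∂μ := by
  rw [← real_inner_self_eq_norm_sq, ContinuousMap.inner_toLp]
  simp [sq]

lemma exists_extension_of_inner_eq {X : Type*} [MetricSpace X] [CompactSpace X]
    [MeasurableSpace X] [BorelSpace X] {H : Type*} [NormedAddCommGroup H] [InnerProductSpace ℝ H]
    [CompleteSpace H] {M : C(X, ℝ) → H} {m : SignedMeasure X} {C : SignedMeasure (X × X)}
    (hM : ∀ φ ψ : C(X, ℝ), inner ℝ (M φ) (M ψ) =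
      signedIntegral C (fun q => φ q.1 * ψ q.2) + signedIntegral m φ * signedIntegral m ψ) :
    ∃ (μ : Measure X) (_ : IsFiniteMeasure μ) (T : Lp ℝ 2 μ →L[ℝ] H),
      ∀ φ : C(X, ℝ), T (ContinuousMap.toLp 2 μ ℝ φ) = M φ := by
  obtain ⟨μ, hμ, hb⟩ : ∃ μ : Measure X, ∃ _ : IsFiniteMeasure μ, ∀ φ : C(X, ℝ),
      signedIntegral C (fun q => φ q.1 * φ q.2) + signedIntegral m φ * signedIntegral m φ ≤
        (1 + m.totalVariation.real Set.univ) * ∫ x, φ x ^ 2 ∂μ :=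
    ⟨_, inferInstance, signedIntegral_mul_self_add_sq_le m C⟩
  refine ⟨μ, inferInstance, (IsLinearMap.mk' M (isLinearMap_of_inner_eq hM)).extendOfNorm
    (ContinuousMap.toLp 2 μ ℝ : C(X, ℝ) →L[ℝ] _).toLinearMap, ?_⟩
  refine fun φ => LinearMap.extendOfNorm_eq (f := (IsLinearMap.mk' M (isLinearMap_of_inner_eq hM)))
    (e := (ContinuousMap.toLp 2 μ ℝ : C(X, ℝ) →L[ℝ] _).toLinearMap)
    (ContinuousMap.toLp_denseRange ℝ μ ℝ (by simp))
    ⟨√(1 + m.totalVariation.real Set.univ), fun φ => ?_⟩ φ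
  refine le_of_sq_le_sq ?_ (by positivity)
  rw [mul_pow, Real.sq_sqrt (by positivity), IsLinearMap.mk'_apply,
    ContinuousLinearMap.coe_coe, norm_sq_continuousMap_toLp, ← real_inner_self_eq_norm_sq, hM]
  exact hb φ

/-- The step function `∑ⱼ φ(xⱼ) 𝟙_{Iⱼ}` on `D` attached to level `n` of a Riemann system. -/
noncomputable def riemannStep {α : Type*} [MeasurableSpace α] [PseudoMetricSpace α] {D : Set α}
    (R : RiemannSystem D) (φ : D → ℝ) (n : ℕ) (x : D) : ℝ :=
  ∑ j ∈ R.J n, (if h : R.tag n j ∈ D then φ ⟨R.tag n j, h⟩ else 0) *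
    (Subtype.val ⁻¹' R.piece n j).indicator (fun _ => (1 : ℝ)) x

lemma RiemannSystem.piece_subset {α : Type*} [MeasurableSpace α] [PseudoMetricSpace α]
    {D : Set α} (R : RiemannSystem D) {n j : ℕ} (hj : j ∈ R.J n) : R.piece n j ⊆ D :=
  (Set.subset_biUnion_of_mem (u := fun j => R.piece n j) hj).trans (R.cover n).subset

lemma eventually_abs_riemannStep_sub_le {α : Type*} [MeasurableSpace α] [PseudoMetricSpace α]
    {D : Set α} (hD : IsCompact D) (R : RiemannSystem D) (φ : C(D, ℝ)) {ε : ℝ} (hε : 0 < ε) :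
    ∀ᶠ n in atTop, ∀ x, |riemannStep R φ n x - φ x| ≤ ε := by
  have : CompactSpace D := isCompact_iff_compactSpace.1 hD
  obtain ⟨δ, hδ, h⟩ := Metric.uniformContinuous_iff.1
    (CompactSpace.uniformContinuous_of_continuous φ.continuous) ε hε
  obtain ⟨N, hN⟩ := R.diam_small (δ / 2) (by positivity)
  filter_upwards [eventually_ge_atTop N] with n hn x
  have hx : (x : α) ∈ ⋃ j ∈ R.J n, R.piece n j := by
    rw [R.cover]; exact x.2
  simp only [Set.mem_iUnion] at hx
  obtain ⟨j, hj, hxj⟩ := hx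
  have hsub := R.piece_subset hj
  have ht : R.tag n j ∈ D := hsub (R.tag_mem n j hj)
  have hstep : riemannStep R φ n x = φ ⟨R.tag n j, ht⟩ := by
    rw [riemannStep, Finset.sum_eq_single_of_mem j hj]
    · simp [ht, hxj]
    · intro k hk hkj
      have : (x : α) ∉ R.piece n k := fun hxk =>
        Set.disjoint_left.1 (R.disj n k hk j hj hkj) hxk hxj
      simp [this]
  rw [hstep, ← Real.dist_eq]
  refine (h ?_).le
  refine lt_of_le_of_lt ((Metric.dist_le_diam_of_mem (hD.isBounded.subset hsub)
    (R.tag_mem n j hj) hxj).trans (hN n hn j hj)) (by linarith)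

lemma exists_finite_partition_diam_le {α : Type*} [MeasurableSpace α] [PseudoMetricSpace α]
    [OpensMeasurableSpace α] [TopologicalSpace.SeparableSpace α] [Nonempty α] {D : Set α}
    (hD : IsCompact D) (hDm : MeasurableSet D) {ε : ℝ} (hε : 0 < ε) :
    ∃ (J : Finset ℕ) (I : ℕ → Set α), (∀ j, MeasurableSet (I j)) ∧ (∀ j ∈ J, (I j).Nonempty) ∧
      Pairwise (Function.onFun Disjoint I) ∧ (⋃ j ∈ J, I j) = D ∧
      ∀ j, Metric.diam (I j) ≤ ε := by
  obtain ⟨t, ht⟩ := hD.elim_finite_subcover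
    (fun i => Metric.ball (TopologicalSpace.denseSeq α i) (ε / 2))
    (fun i => Metric.isOpen_ball) (fun x _ => by
      obtain ⟨i, hi⟩ := (TopologicalSpace.denseRange_denseSeq α).exists_dist_lt x (half_pos hε)
      exact Set.mem_iUnion.2 ⟨i, hi⟩)
  let f : ℕ → Set α := fun i =>
    if i ∈ t then D ∩ Metric.ball (TopologicalSpace.denseSeq α i) (ε / 2) else ∅
  have hfm : ∀ i, MeasurableSet (f i) := fun i => by
    by_cases hi : i ∈ t
    · simpa [f, hi] using hDm.inter measurableSet_ball
    · simp [f, hi]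
  have hfb : ∀ i, f i ⊆ Metric.ball (TopologicalSpace.denseSeq α i) (ε / 2) := fun i => by
    by_cases hi : i ∈ t <;> simp [f, hi]
  refine ⟨t.filter fun j => (disjointed f j).Nonempty, disjointed f,
    fun j => MeasurableSet.disjointed hfm j, fun j hj => (Finset.mem_filter.1 hj).2,
    disjoint_disjointed f, ?_, fun j => ?_⟩
  · have hU : (⋃ j ∈ t.filter fun j => (disjointed f j).Nonempty, disjointed f j)
        = ⋃ j, disjointed f j := by
      apply subset_antisymm
      · exact Set.iUnion₂_subset fun j _ => Set.subset_iUnion _ j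
      · intro x hx
        obtain ⟨j, hj⟩ := Set.mem_iUnion.1 hx
        have hjt : j ∈ t := by
          by_contra hjt
          have := disjointed_subset f j hj
          simp [f, hjt] at this
        exact Set.mem_biUnion (Finset.mem_coe.2 (Finset.mem_filter.2 ⟨hjt, ⟨x, hj⟩⟩)) hj
    rw [hU, iUnion_disjointed]
    apply subset_antisymm
    · refine Set.iUnion_subset fun i => ?_
      by_cases hi : i ∈ t <;> simp [f, hi]
    · intro x hx
      obtain ⟨i, hi, hxi⟩ := Set.mem_iUnion₂.1 (ht hx)
      refine Set.mem_iUnion.2 ⟨i, ?_⟩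
      simp only [f, hi, if_true]
      exact ⟨hx, hxi⟩
  · calc Metric.diam (disjointed f j)
        ≤ Metric.diam (Metric.ball (TopologicalSpace.denseSeq α j) (ε / 2)) :=
          Metric.diam_mono ((disjointed_subset f j).trans (hfb j)) Metric.isBounded_ball
      _ ≤ 2 * (ε / 2) := Metric.diam_ball (by positivity)
      _ = ε := by ring

lemma nonempty_riemannSystem {α : Type*} [MeasurableSpace α] [PseudoMetricSpace α]
    [OpensMeasurableSpace α] [TopologicalSpace.SeparableSpace α] [Nonempty α] {D : Set α}
    (hD : IsCompact D) (hDm : MeasurableSet D) : Nonempty (RiemannSystem D) := by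
  choose J I hm hne hd hc hdiam using fun n : ℕ =>
    exists_finite_partition_diam_le hD hDm (Nat.one_div_pos_of_nat (α := ℝ) (n := n))
  refine ⟨⟨J, I, fun n j => if h : (I n j).Nonempty then h.some else Classical.arbitrary α,
    fun n j _ => hm n j, hne, fun n j _ k _ hjk => hd n hjk, hc, fun n j hj => ?_,
    fun ε hε => ?_⟩⟩
  · rw [dif_pos (hne n j hj)]
    exact (hne n j hj).some_mem
  · obtain ⟨N, hN⟩ := exists_nat_one_div_lt hε
    refine ⟨N, fun n hn j _ => (hdiam n j).trans (le_trans ?_ hN.le)⟩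
    exact Nat.one_div_le_one_div hn

/-- The `L²`-valued vector measure `A ↦ T 𝟙_A` on `D` attached to an operator `T` on `L²(D, μ)`. -/
noncomputable def L2VectorMeasure.ofOperator {α : Type*} [MeasurableSpace α] {D : Set α}
    {Ω : Type*} [MeasurableSpace Ω] {P : Measure Ω} (μ : Measure D) [IsFiniteMeasure μ]
    (T : Lp ℝ 2 μ →L[ℝ] Lp ℝ 2 P) : L2VectorMeasure D P where
  meas s := if h : MeasurableSet s ∧ s ⊆ D then
    T (indicatorConstLp 2 (measurable_subtype_coe h.1) (measure_ne_top μ _) 1) else 0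
  empty' := by simp
  not_measurable' s hs := dif_neg fun h => hs h.1
  not_subset' s hs := dif_neg fun h => hs h.2
  countably_additive f hm hs hd := by
    have hU : MeasurableSet (⋃ n, f n) ∧ (⋃ n, f n) ⊆ D :=
      ⟨MeasurableSet.iUnion hm, Set.iUnion_subset hs⟩
    simp only [hm, hs, and_self, dite_true, dif_pos hU]
    refine T.hasSum ?_
    have hm' : ∀ n, MeasurableSet (Subtype.val ⁻¹' f n : Set D) :=
      fun n => measurable_subtype_coe (hm n)
    have hd' : Pairwise (Function.onFun Disjoint fun n => (Subtype.val ⁻¹' f n : Set D)) :=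
      fun i j hij => (hd hij).preimage _
    have hsum : ∀ F : Finset ℕ,
        ∑ n ∈ F, indicatorConstLp 2 (hm' n) (measure_ne_top μ _) (1 : ℝ) =
        indicatorConstLp 2 (F.measurableSet_biUnion fun n _ => hm' n) (measure_ne_top μ _) 1 := by
      intro F
      induction F using Finset.induction_on with
      | empty => simp
      | insert a F ha ih =>
        rw [Finset.sum_insert ha, ih, ← indicatorConstLp_disjoint_union]
        · congr 1
          simp
        · simp only [Set.disjoint_iUnion_right]
          intro i hi
          exact hd' (by rintro rfl; exact ha hi)
    simp only [HasSum, hsum, SummationFilter.unconditional_filter]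
    refine tendsto_indicatorConstLp_set (by simp) ?_
    have hsd : ∀ F : Finset ℕ, μ (symmDiff (⋃ n ∈ F, (Subtype.val ⁻¹' f n : Set D))
        (Subtype.val ⁻¹' ⋃ n, f n)) = μ (⋃ n, (Subtype.val ⁻¹' f n : Set D))
          - ∑ n ∈ F, μ (Subtype.val ⁻¹' f n) := by
      intro F
      have hsub : (⋃ n ∈ F, (Subtype.val ⁻¹' f n : Set D)) ⊆ ⋃ n, (Subtype.val ⁻¹' f n : Set D) :=
        Set.iUnion₂_subset fun n _ => Set.subset_iUnion (fun n => (Subtype.val ⁻¹' f n : Set D)) n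
      rw [Set.preimage_iUnion, symmDiff_of_le hsub,
        measure_sdiff hsub (F.measurableSet_biUnion fun n _ => hm' n).nullMeasurableSet
          (measure_ne_top μ _), measure_biUnion_finset (fun i _ j _ hij => hd' hij)
          (fun n _ => hm' n)]
    simp only [hsd]
    rw [measure_iUnion hd' hm']
    have htop : ∑' n, μ (Subtype.val ⁻¹' f n : Set D) ≠ ⊤ := by
      rw [← measure_iUnion hd' hm']
      exact measure_ne_top μ _
    have := ENNReal.Tendsto.sub (tendsto_const_nhds (x := ∑' n, μ (Subtype.val ⁻¹' f n : Set D)))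
      (ENNReal.summable (f := fun n => μ (Subtype.val ⁻¹' f n : Set D))).hasSum (Or.inl htop)
    simpa using this

lemma L2VectorMeasure.ofOperator_meas {α : Type*} [MeasurableSpace α] {D : Set α}
    {Ω : Type*} [MeasurableSpace Ω] {P : Measure Ω} (μ : Measure D) [IsFiniteMeasure μ]
    (T : Lp ℝ 2 μ →L[ℝ] Lp ℝ 2 P) {s : Set α} (hs : MeasurableSet s) (hsD : s ⊆ D) :
    (ofOperator μ T).meas s =
      T (indicatorConstLp 2 (measurable_subtype_coe hs) (measure_ne_top μ _) 1) :=
  dif_pos ⟨hs, hsD⟩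

lemma tendsto_riemannSum_ofOperator {α : Type*} [MeasurableSpace α] [MetricSpace α]
    [BorelSpace α] {D : Set α} (hD : IsCompact D) [CompactSpace D]
    {Ω : Type*} [MeasurableSpace Ω] {P : Measure Ω} (μ : Measure D) [IsFiniteMeasure μ]
    (T : Lp ℝ 2 μ →L[ℝ] Lp ℝ 2 P) (φ : C(D, ℝ)) (R : RiemannSystem D) :
    Tendsto (fun n => ∑ j ∈ R.J n,
      (if h : R.tag n j ∈ D then φ ⟨R.tag n j, h⟩ else 0) •
        (L2VectorMeasure.ofOperator μ T).meas (R.piece n j))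
      atTop (𝓝 (T (ContinuousMap.toLp 2 μ ℝ φ))) := by
  have hg : ∀ n, MemLp (riemannStep R φ n) 2 μ := by
    intro n
    refine memLp_finsetSum _ fun j hj => ?_
    exact ((memLp_indicator_const 2 (measurable_subtype_coe (R.measurable n j hj)) (1 : ℝ)
      (Or.inr (measure_ne_top μ _))).const_mul _)
  have hsum : ∀ n, ∑ j ∈ R.J n, (if h : R.tag n j ∈ D then φ ⟨R.tag n j, h⟩ else 0) •
      (L2VectorMeasure.ofOperator μ T).meas (R.piece n j) = T ((hg n).toLp) := by
    intro n
    have hj : ∀ j ∈ (R.J n).attach, (if h : R.tag n j ∈ D then φ ⟨R.tag n j, h⟩ else 0) •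
        (L2VectorMeasure.ofOperator μ T).meas (R.piece n j) =
        T ((if h : R.tag n j ∈ D then φ ⟨R.tag n j, h⟩ else 0) •
          indicatorConstLp 2 (measurable_subtype_coe (R.measurable n j j.2))
            (measure_ne_top μ _) 1) := by
      intro j _
      rw [map_smul, L2VectorMeasure.ofOperator_meas μ T (R.measurable n j j.2)
        (R.piece_subset j.2)]
    rw [← Finset.sum_attach, Finset.sum_congr rfl hj, ← map_sum]
    congr 1
    apply Lp.ext
    have hall : ∀ᵐ x ∂μ, ∀ j ∈ (R.J n).attach,
        (((if h : R.tag n j ∈ D then φ ⟨R.tag n j, h⟩ else 0) •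
          indicatorConstLp 2 (measurable_subtype_coe (R.measurable n j j.2))
            (measure_ne_top μ _) (1 : ℝ) : Lp ℝ 2 μ) : D → ℝ) x =
        (if h : R.tag n j ∈ D then φ ⟨R.tag n j, h⟩ else 0) *
          (Subtype.val ⁻¹' R.piece n j).indicator (fun _ => (1 : ℝ)) x := by
      rw [Finset.eventually_all]
      intro j _
      filter_upwards [Lp.coeFn_smul (if h : R.tag n j ∈ D then φ ⟨R.tag n j, h⟩ else 0)
        (indicatorConstLp 2 (measurable_subtype_coe (R.measurable n j j.2))
            (measure_ne_top μ _) (1 : ℝ) : Lp ℝ 2 μ),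
        indicatorConstLp_coeFn (p := 2) (c := (1 : ℝ))
          (hs := measurable_subtype_coe (R.measurable n j j.2))
          (hμs := measure_ne_top μ _)] with x h1 h2
      rw [h1, Pi.smul_apply, h2, smul_eq_mul]
    filter_upwards [hall, Lp.coeFn_fun_finsetSum (R.J n).attach fun j =>
      ((if h : R.tag n j ∈ D then φ ⟨R.tag n j, h⟩ else 0) •
          indicatorConstLp 2 (measurable_subtype_coe (R.measurable n j j.2))
            (measure_ne_top μ _) (1 : ℝ) : Lp ℝ 2 μ), (hg n).coeFn_toLp] with x h1 h2 h3
    rw [h2, h3, Finset.sum_congr rfl h1, riemannStep, ← Finset.sum_attach (R.J n)]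
  simp only [hsum]
  refine (T.continuous.tendsto _).comp ?_
  rw [Metric.tendsto_nhds]
  intro ε hε
  set K : ℝ := (measureUnivNNReal μ : ℝ) ^ (2 : ENNReal).toReal⁻¹ with hK
  have hK0 : 0 ≤ K := by positivity
  filter_upwards [eventually_abs_riemannStep_sub_le hD R φ
    (show 0 < ε / (K + 1) by positivity)] with n hn
  rw [dist_eq_norm]
  have hle : ‖(hg n).toLp - ContinuousMap.toLp 2 μ ℝ φ‖ ≤ K * (ε / (K + 1)) := by
    refine Lp.norm_le_of_ae_bound (by positivity) ?_
    filter_upwards [Lp.coeFn_sub ((hg n).toLp) (ContinuousMap.toLp 2 μ ℝ φ), (hg n).coeFn_toLp,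
      ContinuousMap.coeFn_toLp (p := 2) (𝕜 := ℝ) μ φ] with x h1 h2 h3
    rw [h1, Pi.sub_apply, h2, h3]
    exact hn x
  refine hle.trans_lt ?_
  rw [mul_div_assoc', div_lt_iff₀ (by positivity)]
  nlinarith

lemma signedMeasure_apply_eq_sub {α : Type*} [MeasurableSpace α] (ν : SignedMeasure α)
    {s : Set α} (hs : MeasurableSet s) :
    ν s = ν.toJordanDecomposition.posPart.real s - ν.toJordanDecomposition.negPart.real s := by
  conv_lhs => rw [← ν.toSignedMeasure_toJordanDecomposition]
  rw [JordanDecomposition.toSignedMeasure, Measure.toSignedMeasure_sub_apply hs]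

lemma signedMeasure_eq_of_forall_signedIntegral_eq {X : Type*} [TopologicalSpace X]
    [CompactSpace X] [HasOuterApproxClosed X] [MeasurableSpace X] [BorelSpace X]
    {ν ν' : SignedMeasure X}
    (h : ∀ φ : C(X, ℝ), signedIntegral ν φ = signedIntegral ν' φ) : ν = ν' := by
  have key : ν.toJordanDecomposition.posPart + ν'.toJordanDecomposition.negPart =
      ν'.toJordanDecomposition.posPart + ν.toJordanDecomposition.negPart := by
    refine ext_of_forall_integral_eq_of_IsFiniteMeasure fun φ => ?_
    have hi : ∀ (μ : Measure X) [IsFiniteMeasure μ], Integrable φ μ :=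
      fun μ _ => φ.continuous.integrable_of_compactSpace μ
    have := h φ.toContinuousMap
    simp only [signedIntegral, BoundedContinuousFunction.coe_toContinuousMap] at this
    rw [integral_add_measure (hi _) (hi _), integral_add_measure (hi _) (hi _)]
    linarith
  ext s hs
  have := congrArg (fun μ : Measure X => μ.real s) key
  beta_reduce at this
  rw [measureReal_add_apply, measureReal_add_apply] at this
  rw [signedMeasure_apply_eq_sub ν hs, signedMeasure_apply_eq_sub ν' hs]
  linarith

lemma integral_riemannStep {α : Type*} [MeasurableSpace α] [PseudoMetricSpace α] {D : Set α}
    (R : RiemannSystem D) (φ : D → ℝ) (n : ℕ) (μ : Measure D) [IsFiniteMeasure μ] :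
    ∫ x, riemannStep R φ n x ∂μ = ∑ j ∈ R.J n,
      (if h : R.tag n j ∈ D then φ ⟨R.tag n j, h⟩ else 0) *
        μ.real (Subtype.val ⁻¹' R.piece n j) := by
  simp only [riemannStep]
  rw [integral_finsetSum]
  · refine Finset.sum_congr rfl fun j hj => ?_
    rw [integral_const_mul, integral_indicator_const _
      (measurable_subtype_coe (R.measurable n j hj)), smul_eq_mul, mul_one]
  · intro j hj
    exact ((integrable_const (1 : ℝ)).indicator
      (measurable_subtype_coe (R.measurable n j hj))).const_mul _

lemma integrable_riemannStep {α : Type*} [MeasurableSpace α] [PseudoMetricSpace α] {D : Set α}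
    (R : RiemannSystem D) (φ : D → ℝ) (n : ℕ) (μ : Measure D) [IsFiniteMeasure μ] :
    Integrable (riemannStep R φ n) μ :=
  integrable_finsetSum _ fun j hj => ((integrable_const (1 : ℝ)).indicator
    (measurable_subtype_coe (R.measurable n j hj))).const_mul _

lemma signedIntegral_riemannStep {α : Type*} [MeasurableSpace α] [PseudoMetricSpace α] {D : Set α}
    (R : RiemannSystem D) (φ : D → ℝ) (n : ℕ) (ν : SignedMeasure D) :
    signedIntegral ν (riemannStep R φ n) = ∑ j ∈ R.J n,
      (if h : R.tag n j ∈ D then φ ⟨R.tag n j, h⟩ else 0) * ν (Subtype.val ⁻¹' R.piece n j) := by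
  rw [signedIntegral, integral_riemannStep, integral_riemannStep, ← Finset.sum_sub_distrib]
  refine Finset.sum_congr rfl fun j hj => ?_
  rw [← mul_sub, signedMeasure_apply_eq_sub ν (measurable_subtype_coe (R.measurable n j hj))]

lemma tendsto_signedIntegral_riemannStep {α : Type*} [MeasurableSpace α] [PseudoMetricSpace α]
    [OpensMeasurableSpace α] {D : Set α} (hD : IsCompact D) (R : RiemannSystem D) (φ : C(D, ℝ))
    (ν : SignedMeasure D) :
    Tendsto (fun n => signedIntegral ν (riemannStep R φ n)) atTop (𝓝 (signedIntegral ν φ)) := by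
  have : CompactSpace D := isCompact_iff_compactSpace.1 hD
  have key : ∀ (μ : Measure D) [IsFiniteMeasure μ],
      Tendsto (fun n => ∫ x, riemannStep R φ n x ∂μ) atTop (𝓝 (∫ x, φ x ∂μ)) := by
    intro μ _
    rw [Metric.tendsto_nhds]
    intro ε hε
    have hK : 0 ≤ μ.real Set.univ := measureReal_nonneg
    filter_upwards [eventually_abs_riemannStep_sub_le hD R φ
      (show 0 < ε / (μ.real Set.univ + 1) by positivity)] with n hn
    rw [Real.dist_eq, ← integral_sub (integrable_riemannStep R φ n μ)
      (φ.continuous.integrable_of_compactSpace μ), ← Real.norm_eq_abs]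
    refine (norm_integral_le_of_norm_le_const (ae_of_all _ hn)).trans_lt ?_
    rw [div_mul_eq_mul_div, div_lt_iff₀ (by positivity)]
    nlinarith
  exact (key _).sub (key _)

/-- The signed measure `A ↦ ⟪X, Mt A⟫` on `D` obtained by pairing an `L²`-valued vector measure
with `X ∈ L²`. -/
noncomputable def L2VectorMeasure.pairing {α : Type*} [MeasurableSpace α] {D : Set α}
    (hD : MeasurableSet D) {Ω : Type*} [MeasurableSpace Ω] {P : Measure Ω}
    (Mt : L2VectorMeasure D P) (X : Lp ℝ 2 P) : SignedMeasure D where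
  measureOf' s := if MeasurableSet s then inner ℝ X (Mt.meas (Subtype.val '' s)) else 0
  empty' := by simp [Mt.empty']
  not_measurable' s hs := if_neg hs
  m_iUnion' f hm hd := by
    simp only [hm, MeasurableSet.iUnion hm, if_true, Set.image_iUnion]
    exact (innerSL ℝ X).hasSum (Mt.countably_additive (fun n => Subtype.val '' f n)
      (fun n => hD.subtype_image (hm n)) (fun n => Subtype.coe_image_subset D (f n))
      fun i j hij => (Set.disjoint_image_iff Subtype.val_injective).2 (hd hij))

lemma L2VectorMeasure.pairing_preimage {α : Type*} [MeasurableSpace α] {D : Set α}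
    (hD : MeasurableSet D) {Ω : Type*} [MeasurableSpace Ω] {P : Measure Ω}
    (Mt : L2VectorMeasure D P) (X : Lp ℝ 2 P) {s : Set α} (hs : MeasurableSet s) (hsD : s ⊆ D) :
    Mt.pairing hD X (Subtype.val ⁻¹' s) = inner ℝ X (Mt.meas s) := by
  have h : Mt.pairing hD X (Subtype.val ⁻¹' s) =
      inner ℝ X (Mt.meas (Subtype.val '' (Subtype.val ⁻¹' s : Set D))) :=
    if_pos (measurable_subtype_coe hs)
  rw [h, Subtype.image_preimage_coe, Set.inter_eq_right.2 hsD]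

@[ext]
lemma L2VectorMeasure.ext {α : Type*} [MeasurableSpace α] {D : Set α} {Ω : Type*}
    [MeasurableSpace Ω] {P : Measure Ω} {Mt Mt' : L2VectorMeasure D P}
    (h : ∀ s, MeasurableSet s → s ⊆ D → Mt.meas s = Mt'.meas s) : Mt = Mt' := by
  have : Mt.meas = Mt'.meas := by
    funext s
    by_cases hs : MeasurableSet s
    · by_cases hsD : s ⊆ D
      · exact h s hs hsD
      · rw [Mt.not_subset' s hsD, Mt'.not_subset' s hsD]
    · rw [Mt.not_measurable' s hs, Mt'.not_measurable' s hs]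
  cases Mt
  cases Mt'
  congr

lemma signedIntegral_pairing_eq {α : Type*} [MeasurableSpace α] [PseudoMetricSpace α]
    [OpensMeasurableSpace α] {D : Set α} (hD : IsCompact D) (hDm : MeasurableSet D)
    {Ω : Type*} [MeasurableSpace Ω] {P : Measure Ω} (Mt : L2VectorMeasure D P)
    (R : RiemannSystem D) (φ : C(D, ℝ)) {Y : Lp ℝ 2 P}
    (h : Tendsto (fun n => ∑ j ∈ R.J n,
      (if h : R.tag n j ∈ D then φ ⟨R.tag n j, h⟩ else 0) • Mt.meas (R.piece n j)) atTop (𝓝 Y))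
    (X : Lp ℝ 2 P) : signedIntegral (Mt.pairing hDm X) φ = inner ℝ X Y := by
  refine tendsto_nhds_unique (tendsto_signedIntegral_riemannStep hD R φ _) ?_
  refine (((innerSL ℝ X).continuous.tendsto Y).comp h).congr fun n => ?_
  rw [signedIntegral_riemannStep, Function.comp_apply, map_sum]
  refine Finset.sum_congr rfl fun j hj => ?_
  rw [map_smul, innerSL_apply_apply, smul_eq_mul,
    Mt.pairing_preimage hDm X (R.measurable n j hj) (R.piece_subset hj)]

lemma L2VectorMeasure.eq_of_tendsto_riemannSum {α : Type*} [MeasurableSpace α] [MetricSpace α]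
    [BorelSpace α] [TopologicalSpace.SeparableSpace α] [Nonempty α] {D : Set α}
    (hD : IsCompact D) {Ω : Type*} [MeasurableSpace Ω] {P : Measure Ω}
    {M : C(D, ℝ) → Lp ℝ 2 P} {Mt Mt' : L2VectorMeasure D P}
    (h : ∀ φ : C(D, ℝ), ∀ R : RiemannSystem D, Tendsto (fun n => ∑ j ∈ R.J n,
      (if h : R.tag n j ∈ D then φ ⟨R.tag n j, h⟩ else 0) • Mt.meas (R.piece n j))
      atTop (𝓝 (M φ)))
    (h' : ∀ φ : C(D, ℝ), ∀ R : RiemannSystem D, Tendsto (fun n => ∑ j ∈ R.J n,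
      (if h : R.tag n j ∈ D then φ ⟨R.tag n j, h⟩ else 0) • Mt'.meas (R.piece n j))
      atTop (𝓝 (M φ))) : Mt = Mt' := by
  have : CompactSpace D := isCompact_iff_compactSpace.1 hD
  obtain ⟨R⟩ := nonempty_riemannSystem hD hD.measurableSet
  ext1 s hs hsD
  refine ext_inner_left ℝ fun X => ?_
  have hX : Mt.pairing hD.measurableSet X = Mt'.pairing hD.measurableSet X :=
    signedMeasure_eq_of_forall_signedIntegral_eq fun φ => by
      rw [signedIntegral_pairing_eq hD _ Mt R φ (h φ R),
        signedIntegral_pairing_eq hD _ Mt' R φ (h' φ R)]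
  rw [← Mt.pairing_preimage hD.measurableSet X hs hsD, hX, Mt'.pairing_preimage _ X hs hsD]

/-- Stochastic Riesz representation: if `M : C(D,ℝ) → L²(Ω,P)` has mean and covariance
represented by a finite signed Borel measure `m` on `D` and a finite signed Borel measure `C`
on `D × D`, then there is a unique `L²`-valued vector measure `Mt` on the Borel subsets of `D`
such that for every `φ ∈ C(D,ℝ)` and every Riemann system of `D`, the Riemann sums
`Σ_j φ(x_j^n) • Mt(I_j^n)` converge in `L²` to `M(φ)`. -/
theorem exists_unique_random_measure_riesz
    {d : ℕ} (D : Set (EuclideanSpace ℝ (Fin d))) (hD : IsCompact D)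
    {Ω : Type*} [MeasurableSpace Ω] (P : Measure Ω) [IsProbabilityMeasure P]
    (M : C(D, ℝ) → Lp ℝ 2 P)
    (m : SignedMeasure D) (C : SignedMeasure (D × D))
    (hmean : ∀ φ : C(D, ℝ), ∫ ω, (M φ : Ω → ℝ) ω ∂P = signedIntegral m φ)
    (hcov : ∀ φ ϕ : C(D, ℝ),
      (∫ ω, (M φ : Ω → ℝ) ω * (M ϕ : Ω → ℝ) ω ∂P) -
          (∫ ω, (M φ : Ω → ℝ) ω ∂P) * (∫ ω, (M ϕ : Ω → ℝ) ω ∂P) =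
        signedIntegral C (fun q => φ q.1 * ϕ q.2)) :
    ∃! Mt : L2VectorMeasure D P,
      ∀ φ : C(D, ℝ), ∀ R : RiemannSystem D,
        Tendsto (fun n => ∑ j ∈ R.J n,
            (if h : R.tag n j ∈ D then φ ⟨R.tag n j, h⟩ else 0) • Mt.meas (R.piece n j))
          atTop (𝓝 (M φ)) := by
  have : CompactSpace D := isCompact_iff_compactSpace.1 hD
  have hM : ∀ φ ψ : C(D, ℝ), inner ℝ (M φ) (M ψ) =
      signedIntegral C (fun q => φ q.1 * ψ q.2) + signedIntegral m φ * signedIntegral m ψ := by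
    intro φ ψ
    rw [← hcov, hmean, hmean, sub_add_cancel, L2.inner_def]
    simp [mul_comm]
  obtain ⟨μ, _, T, hT⟩ := exists_extension_of_inner_eq hM
  have hex : ∀ φ : C(D, ℝ), ∀ R : RiemannSystem D, Tendsto (fun n => ∑ j ∈ R.J n,
      (if h : R.tag n j ∈ D then φ ⟨R.tag n j, h⟩ else 0) •
        (L2VectorMeasure.ofOperator μ T).meas (R.piece n j)) atTop (𝓝 (M φ)) := by
    intro φ R
    rw [← hT]
    exact tendsto_riemannSum_ofOperator hD μ T φ R
  exact ⟨_, hex, fun Mt hMt => L2VectorMeasure.eq_of_tendsto_riemannSum hD hMt hex⟩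
end

section
/- Let D ⊆ ℝ^d and E ⊆ ℝ^p be compact sets, K a locally bounded cf-m kernel from D to finite signed Borel measures on E, and ψ : D×E → ℝ continuous. Then the function x ↦ ∫_E ψ(x,y) dK(x,·)(y) is continuous on D. -/
open MeasureTheory Filter Topology

lemma abs_signedIntegral_sub_le {α : Type*} [MeasurableSpace α] (μ : SignedMeasure α)
    {f g : α → ℝ} {C : ℝ} (hfp : Integrable f μ.toJordanDecomposition.posPart)
    (hfn : Integrable f μ.toJordanDecomposition.negPart)
    (hgp : Integrable g μ.toJordanDecomposition.posPart)
    (hgn : Integrable g μ.toJordanDecomposition.negPart) (h : ∀ x, |f x - g x| ≤ C) :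
    |signedIntegral μ f - signedIntegral μ g| ≤ C * μ.totalVariation.real Set.univ := by
  have hp := norm_integral_le_of_norm_le_const (μ := μ.toJordanDecomposition.posPart)
    (f := fun x => f x - g x) (C := C) (ae_of_all _ h)
  have hn := norm_integral_le_of_norm_le_const (μ := μ.toJordanDecomposition.negPart)
    (f := fun x => f x - g x) (C := C) (ae_of_all _ h)
  rw [integral_sub hfp hgp, Real.norm_eq_abs] at hp
  rw [integral_sub hfn hgn, Real.norm_eq_abs] at hn
  rw [SignedMeasure.totalVariation, measureReal_add_apply, mul_add]
  unfold signedIntegral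
  rw [abs_le] at *
  constructor <;> linarith [hp.1, hp.2, hn.1, hn.2]

lemma signedIntegral_simpleFunc {α : Type*} [MeasurableSpace α] (μ : SignedMeasure α)
    (s : SimpleFunc α ℝ) : signedIntegral μ s = ∑ c ∈ s.range, μ (s ⁻¹' {c}) * c := by
  unfold signedIntegral
  rw [SimpleFunc.integral_eq_sum _ (s.integrable_of_isFiniteMeasure),
    SimpleFunc.integral_eq_sum _ (s.integrable_of_isFiniteMeasure), ← Finset.sum_sub_distrib]
  refine Finset.sum_congr rfl fun c _ => ?_
  rw [μ.apply_eq_posPart_real_sub_negPart_real (s.measurableSet_fiber c), smul_eq_mul, smul_eq_mul,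
    sub_mul]

lemma exists_simpleFunc_abs_sub_le {α : Type*} [MeasurableSpace α] {f : α → ℝ}
    (hf : Measurable f) {M : ℝ} (hM : ∀ x, |f x| ≤ M) {ε : ℝ} (hε : 0 < ε) :
    ∃ s : SimpleFunc α ℝ, ∀ x, |f x - s x| ≤ ε := by
  have hm : Measurable fun x => ⌊f x / ε⌋ := Int.measurable_floor.comp (hf.div_const ε)
  have hfin : (Set.range fun x => ⌊f x / ε⌋).Finite := by
    refine (Set.finite_Icc ⌊-M / ε⌋ ⌊M / ε⌋).subset ?_
    rintro _ ⟨x, rfl⟩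
    have := abs_le.1 (hM x)
    exact ⟨Int.floor_mono (by gcongr; exact this.1), Int.floor_mono (by gcongr; exact this.2)⟩
  let n : SimpleFunc α ℤ := ⟨_, fun c => hm (measurableSet_singleton c), hfin⟩
  refine ⟨n.map fun k : ℤ => (k : ℝ) * ε, fun x => ?_⟩
  change |f x - (⌊f x / ε⌋ : ℝ) * ε| ≤ ε
  have h1 := (le_div_iff₀ hε).1 (Int.floor_le (f x / ε))
  have h2 := (div_lt_iff₀ hε).1 (Int.lt_floor_add_one (f x / ε))
  rw [abs_le]
  constructor <;> linarith

/-- If `K` is a locally bounded cf-m kernel from the compact set `D` to finite signed Borel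
measures on the compact set `E`, and `ψ : D × E → ℝ` is continuous, then
`x ↦ ∫_E ψ(x,y) dK(x,·)(y)` is continuous on `D`. -/
theorem continuous_kernel_integral_of_continuous
    {d p : ℕ} (D : Set (EuclideanSpace ℝ (Fin d))) (E : Set (EuclideanSpace ℝ (Fin p)))
    (hD : IsCompact D) (hE : IsCompact E)
    (K : D → SignedMeasure E)
    (hcfm : ∀ A : Set E, MeasurableSet A → Continuous fun x : D => K x A)
    (hbdd : (⨆ x : D, (K x).totalVariation Set.univ) < ⊤)
    (ψ : D × E → ℝ) (hψ : Continuous ψ) :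
    Continuous fun x : D => signedIntegral (K x) (fun y => ψ (x, y)) := by
  have : CompactSpace E := isCompact_iff_compactSpace.1 hE
  set M := (⨆ x : D, (K x).totalVariation Set.univ).toReal
  have hM : ∀ x, (K x).totalVariation.real Set.univ ≤ M := fun x =>
    ENNReal.toReal_mono hbdd.ne (le_iSup (fun x : D => (K x).totalVariation Set.univ) x)
  have hM0 : 0 ≤ M := ENNReal.toReal_nonneg
  let Ψ : C(D, C(E, ℝ)) := ContinuousMap.curry ⟨ψ, hψ⟩
  have hint : ∀ (x : D) (μ : Measure E) [IsFiniteMeasure μ],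
      Integrable (fun y => ψ (x, y)) μ := fun x μ _ =>
    (Ψ x).continuous.integrable_of_hasCompactSupport (HasCompactSupport.of_compactSpace _)
  refine continuous_iff_continuousAt.2 fun x₀ =>
    continuousAt_of_locally_uniform_approx_of_continuousAt fun u hu => ?_
  obtain ⟨ε, hε, hεu⟩ := Metric.mem_uniformity_dist.1 hu
  have hδ : 0 < ε / (4 * (M + 1)) := by positivity
  set δ := ε / (4 * (M + 1)) with hδdef
  obtain ⟨s, hs⟩ := exists_simpleFunc_abs_sub_le (Ψ x₀).continuous.measurable
    (fun y => (Ψ x₀).norm_coe_le_norm y) hδ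
  refine ⟨{x | dist (Ψ x) (Ψ x₀) < δ}, Ψ.continuous.continuousAt (Metric.ball_mem_nhds _ hδ),
    fun x => signedIntegral (K x) s, ?_, fun x hx => hεu ?_⟩
  · simp only [signedIntegral_simpleFunc]
    exact (continuous_finsetSum _ fun c _ =>
      (hcfm _ (s.measurableSet_fiber c)).mul continuous_const).continuousAt
  · have hclose : ∀ y, |ψ (x, y) - s y| ≤ 2 * δ := fun y => by
      have h1 : |ψ (x, y) - ψ (x₀, y)| ≤ δ :=
        (ContinuousMap.dist_apply_le_dist (f := Ψ x) (g := Ψ x₀) y).trans (le_of_lt hx)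
      have h2 : |ψ (x₀, y) - s y| ≤ δ := hs y
      linarith [abs_sub_le (ψ (x, y)) (ψ (x₀, y)) (s y)]
    rw [Real.dist_eq]
    calc _ ≤ 2 * δ * (K x).totalVariation.real Set.univ :=
          abs_signedIntegral_sub_le _ (hint x _) (hint x _) s.integrable_of_isFiniteMeasure
            s.integrable_of_isFiniteMeasure hclose
      _ ≤ 2 * δ * (M + 1) := by gcongr; linarith [hM x]
      _ = ε / 2 := by rw [hδdef]; field_simp; norm_num
      _ < ε := by linarith
end

section
/- Let D ⊆ ℝ^d and E ⊆ ℝ^p be compact sets, K a locally bounded cf-m kernel from D to finite signed Borel measures on E, and μ a finite signed Borel measure on D. Then there exists a unique finite signed Borel measure T on D×E such that for every continuous ψ : D×E → ℝ, ∫_D ( ∫_E ψ(x,y) dK(x,·)(y) ) dμ(x) = ∫_{D×E} ψ dT. -/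
open MeasureTheory Filter Topology

open ProbabilityTheory

section

variable {α β : Type*} [MeasurableSpace α] [MeasurableSpace β]

lemma MeasureTheory.SignedMeasure.apply_eq_posPart_sub_negPart (s : SignedMeasure α) {A : Set α}
    (hA : MeasurableSet A) :
    s A = s.toJordanDecomposition.posPart.real A - s.toJordanDecomposition.negPart.real A := by
  conv_lhs => rw [← s.toSignedMeasure_toJordanDecomposition]
  simp [JordanDecomposition.toSignedMeasure, hA]

lemma MeasureTheory.SignedMeasure.posPart_apply_eq_iSup (s : SignedMeasure α) {A : Set α}
    (hA : MeasurableSet A) :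
    s.toJordanDecomposition.posPart A =
      ⨆ (B : Set α) (_ : MeasurableSet B ∧ B ⊆ A), ENNReal.ofReal (s B) := by
  apply le_antisymm
  · obtain ⟨i, hi, _, _, hpos, -⟩ := s.toJordanDecomposition_spec
    refine le_iSup₂_of_le (i ∩ A) ⟨hi.inter hA, Set.inter_subset_right⟩ ?_
    rw [hpos, SignedMeasure.toMeasureOfZeroLE_apply _ _ hi hA]
    exact (ENNReal.ofReal_eq_coe_nnreal _).ge
  · refine iSup₂_le fun B ⟨hB, hBA⟩ => ?_
    refine le_trans (ENNReal.ofReal_le_of_le_toReal ?_) (measure_mono hBA)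
    rw [s.apply_eq_posPart_sub_negPart hB]
    exact sub_le_self _ measureReal_nonneg

/-- If `x ↦ s x A` is continuous for all measurable `A`, the positive parts form a kernel. -/
noncomputable def posPartKernel [TopologicalSpace α] [OpensMeasurableSpace α]
    (s : α → SignedMeasure β) (hs : ∀ A, MeasurableSet A → Continuous fun x => s x A) :
    Kernel α β where
  toFun x := (s x).toJordanDecomposition.posPart
  measurable' := by
    refine Measure.measurable_of_measurable_coe _ fun A hA => ?_
    simp_rw [fun x => (s x).posPart_apply_eq_iSup hA]
    refine LowerSemicontinuous.measurable (lowerSemicontinuous_biSup fun B hB => ?_)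
    exact (ENNReal.continuous_ofReal.comp (hs B hB.1)).lowerSemicontinuous

lemma signedIntegral_eq_of_eq_sub {T : SignedMeasure α} {m₁ m₂ : Measure α} [IsFiniteMeasure m₁]
    [IsFiniteMeasure m₂] (hT : T = m₁.toSignedMeasure - m₂.toSignedMeasure) {f : α → ℝ}
    (hf : ∀ m : Measure α, IsFiniteMeasure m → Integrable f m) :
    signedIntegral T f = ∫ x, f x ∂m₁ - ∫ x, f x ∂m₂ := by
  have h : T.toJordanDecomposition.posPart + m₂ = m₁ + T.toJordanDecomposition.negPart := by
    rw [← Measure.toSignedMeasure_eq_toSignedMeasure_iff, Measure.toSignedMeasure_add,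
      Measure.toSignedMeasure_add, ← sub_eq_sub_iff_add_eq_add, ← hT]
    exact T.toSignedMeasure_toJordanDecomposition
  have h' := congrArg (fun m => ∫ x, f x ∂m) h
  simp only [integral_add_measure (hf _ inferInstance) (hf _ inferInstance)] at h'
  rw [signedIntegral]
  linarith

lemma signedMeasure_eq_of_signedIntegral_eq [TopologicalSpace α]
    [HasOuterApproxClosed α] [BorelSpace α] {S T : SignedMeasure α}
    (h : ∀ f : α → ℝ, Continuous f → signedIntegral S f = signedIntegral T f) : S = T := by
  have key : S.toJordanDecomposition.posPart + T.toJordanDecomposition.negPart =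
      T.toJordanDecomposition.posPart + S.toJordanDecomposition.negPart := by
    refine ext_of_forall_integral_eq_of_IsFiniteMeasure fun f => ?_
    have := h f f.continuous
    simp only [signedIntegral] at this
    rw [integral_add_measure (f.integrable _) (f.integrable _),
      integral_add_measure (f.integrable _) (f.integrable _)]
    linarith
  ext A hA
  have := congrArg (Measure.real · A) key
  rw [measureReal_add_apply, measureReal_add_apply] at this
  rw [S.apply_eq_posPart_sub_negPart hA, T.apply_eq_posPart_sub_negPart hA]
  linarith

end

/-- For a locally bounded cf-m kernel `K` from compact `D` to finite signed Borel measures on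
compact `E`, and a finite signed Borel measure `μ` on `D`, there is a unique finite signed Borel
measure `T` on `D × E` such that for every continuous `ψ : D × E → ℝ`,
`∫_D (∫_E ψ(x,y) dK(x,·)(y)) dμ(x) = ∫_{D×E} ψ dT`. -/
theorem exists_unique_measure_of_iterated_kernel_integral
    {d p : ℕ} (D : Set (EuclideanSpace ℝ (Fin d))) (E : Set (EuclideanSpace ℝ (Fin p)))
    (hD : IsCompact D) (hE : IsCompact E)
    (K : D → SignedMeasure E)
    (hcfm : ∀ A : Set E, MeasurableSet A → Continuous fun x : D => K x A)
    (hbdd : (⨆ x : D, (K x).totalVariation Set.univ) < ⊤)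
    (μ : SignedMeasure D) :
    ∃! T : SignedMeasure (D × E),
      ∀ ψ : D × E → ℝ, Continuous ψ →
        signedIntegral μ (fun x => signedIntegral (K x) (fun y => ψ (x, y))) =
          signedIntegral T ψ := by
  have : CompactSpace D := isCompact_iff_compactSpace.1 hD
  have : CompactSpace E := isCompact_iff_compactSpace.1 hE
  have hint : ∀ f : D × E → ℝ, Continuous f → ∀ m : Measure (D × E), IsFiniteMeasure m →
      Integrable f m := fun f hf m _ =>
    hf.integrable_of_hasCompactSupport (HasCompactSupport.of_compactSpace f)
  let P : Kernel D E := posPartKernel K hcfm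
  let N : Kernel D E := posPartKernel (fun x => -K x) fun A hA =>
    (hcfm A hA).neg
  have hN : ∀ x, N x = (K x).toJordanDecomposition.negPart := fun x => by
    change (-K x).toJordanDecomposition.posPart = _
    rw [SignedMeasure.toJordanDecomposition_neg]
    rfl
  have : IsFiniteKernel P := ⟨_, hbdd, fun x => le_trans
    ((Measure.le_add_right le_rfl : P x ≤ (K x).totalVariation) _)
    (le_iSup (fun x : D => (K x).totalVariation Set.univ) x)⟩
  have : IsFiniteKernel N := ⟨_, hbdd, fun x => by
    rw [hN]
    exact le_trans ((Measure.le_add_left le_rfl : _ ≤ (K x).totalVariation) _)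
      (le_iSup (fun x : D => (K x).totalVariation Set.univ) x)⟩
  let a := μ.toJordanDecomposition.posPart
  let b := μ.toJordanDecomposition.negPart
  refine existsUnique_of_exists_of_unique
    ⟨(a ⊗ₘ P + b ⊗ₘ N).toSignedMeasure - (a ⊗ₘ N + b ⊗ₘ P).toSignedMeasure, ?_⟩
    fun S T hS hT => signedMeasure_eq_of_signedIntegral_eq fun ψ hψ =>
      (hS ψ hψ).symm.trans (hT ψ hψ)
  intro ψ hψ
  have hψi := hint ψ hψ
  rw [signedIntegral_eq_of_eq_sub rfl hψi,
    integral_add_measure (hψi _ inferInstance) (hψi _ inferInstance),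
    integral_add_measure (hψi _ inferInstance) (hψi _ inferInstance),
    Measure.integral_compProd (hψi _ inferInstance),
    Measure.integral_compProd (hψi _ inferInstance),
    Measure.integral_compProd (hψi _ inferInstance),
    Measure.integral_compProd (hψi _ inferInstance)]
  have hK : (fun x => signedIntegral (K x) fun y => ψ (x, y)) =
      fun x => ∫ y, ψ (x, y) ∂P x - ∫ y, ψ (x, y) ∂N x := by
    ext x
    rw [hN]
    rfl
  have hi : ∀ (m : Measure D) (κ : Kernel D E), IsFiniteMeasure m → IsFiniteKernel κ →
      Integrable (fun x => ∫ y, ψ (x, y) ∂κ x) m := fun m κ _ _ =>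
    Integrable.integral_compProd (hψi (m ⊗ₘ κ) inferInstance)
  rw [hK, signedIntegral, integral_sub (hi _ _ inferInstance inferInstance)
    (hi _ _ inferInstance inferInstance), integral_sub (hi _ _ inferInstance inferInstance)
    (hi _ _ inferInstance inferInstance)]
  ring
end

section
/- Let X₁, X₂, X₃, X₄ be real random variables on a probability space (Ω,𝒜,ℙ) such that every real linear combination c₁X₁ + c₂X₂ + c₃X₃ + c₄X₄ has a centered Gaussian law (its pushforward of ℙ is gaussianReal 0 v for some v ≥ 0). Then Cov(X₁X₂, X₃X₄) = E[X₁X₃]·E[X₂X₄] + E[X₁X₄]·E[X₂X₃]. -/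
open MeasureTheory ProbabilityTheory

/-- The fourth moment of a centered real Gaussian is three times its squared variance. -/
lemma integral_pow_four_gaussianReal (v : NNReal) :
    ∫ x, x ^ 4 ∂gaussianReal 0 v = 3 * (v : ℝ) ^ 2 := by
  have hderiv : ∀ p : Polynomial ℝ, deriv (fun t => p.eval t * Real.exp (v * t ^ 2 / 2)) =
      fun t => (p.derivative + .C (v : ℝ) * .X * p).eval t * Real.exp (v * t ^ 2 / 2) := by
    intro p
    funext t
    have hexp : HasDerivAt (fun t : ℝ => Real.exp (v * t ^ 2 / 2))
        (Real.exp (v * t ^ 2 / 2) * (v * t)) t :=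
      ((((hasDerivAt_pow 2 t).const_mul (v : ℝ)).div_const 2).congr_deriv (by
        push_cast
        ring)).exp
    refine ((p.hasDerivAt t).mul hexp).deriv.trans ?_
    simp only [Polynomial.eval_add, Polynomial.eval_mul, Polynomial.eval_C, Polynomial.eval_X]
    ring
  have hmom := iteratedDeriv_mgf_zero (X := id) (μ := gaussianReal 0 v)
    (by simp [integrableExpSet_id_gaussianReal]) 4
  have hmgf : mgf id (gaussianReal 0 v) =
      fun t => (1 : Polynomial ℝ).eval t * Real.exp (v * t ^ 2 / 2) := by
    simp [mgf_id_gaussianReal]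
  simp only [hmgf, iteratedDeriv_succ', iteratedDeriv_zero, hderiv] at hmom
  simp at hmom
  rw [← hmom]
  ring

lemma integral_sq_gaussianReal (v : NNReal) : ∫ x, x ^ 2 ∂gaussianReal 0 v = v := by
  rw [← variance_fun_id_gaussianReal (μ := 0) (v := v),
    variance_of_integral_eq_zero (by fun_prop) integral_id_gaussianReal]

section

variable {Ω : Type*} [MeasurableSpace Ω] {P : Measure Ω}

lemma integral_pow_four_eq_of_map_eq_gaussianReal {Y : Ω → ℝ} (hY : Measurable Y) {v : NNReal}
    (h : P.map Y = gaussianReal 0 v) :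
    ∫ ω, Y ω ^ 4 ∂P = 3 * (∫ ω, Y ω ^ 2 ∂P) ^ 2 := by
  have hpow : ∀ n : ℕ, ∫ ω, Y ω ^ n ∂P = ∫ x, x ^ n ∂gaussianReal 0 v := fun n => by
    rw [← h, integral_map hY.aemeasurable (by fun_prop)]
  rw [hpow, hpow, integral_pow_four_gaussianReal, integral_sq_gaussianReal]

lemma memLp_of_map_eq_gaussianReal {Y : Ω → ℝ} (hY : Measurable Y) {v : NNReal}
    (h : P.map Y = gaussianReal 0 v) (p : NNReal) : MemLp Y p P := by
  have := memLp_id_gaussianReal (μ := 0) (v := v) p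
  rw [← h] at this
  exact this.comp_of_map hY.aemeasurable

lemma integral_sq_sum_mul {ι : Type*} [Fintype ι] {X : ι → Ω → ℝ}
    (hX : ∀ i, MemLp (X i) 2 P) (c : ι → ℝ) :
    ∫ ω, (∑ i, c i * X i ω) ^ 2 ∂P = ∑ i, ∑ j, c i * c j * ∫ ω, X i ω * X j ω ∂P := by
  have hint : ∀ i j, Integrable (fun ω => c i * c j * (X i ω * X j ω)) P := fun i j =>
    ((hX i).integrable_mul (hX j)).const_mul _
  simp_rw [← integral_const_mul]
  simp_rw [← integral_finsetSum _ fun j _ => hint _ j]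
  rw [← integral_finsetSum _ fun i _ => integrable_finsetSum _ fun j _ => hint i j]
  congr 1 with ω
  rw [sq, Finset.sum_mul_sum]
  exact Finset.sum_congr rfl fun i _ => Finset.sum_congr rfl fun j _ => by ring

/-- Polarization of the product of four real numbers into fourth powers. -/
lemma mul_four_eq_sum_signs (x y z w : ℝ) :
    (x * y) * (z * w) = (1 / 192) * ∑ a ∈ ({1, -1} : Finset ℝ), ∑ b ∈ ({1, -1} : Finset ℝ),
      ∑ c ∈ ({1, -1} : Finset ℝ),
        a * b * c * (1 * x + a * y + b * z + c * w) ^ 4 := by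
  have hne : (1 : ℝ) ≠ -1 := by norm_num
  simp only [Finset.sum_pair hne]
  ring

end

/-- Isserlis–Wick formula: if every real linear combination of `X₁, X₂, X₃, X₄` has a centered
Gaussian law, then `Cov(X₁X₂, X₃X₄) = E[X₁X₃]E[X₂X₄] + E[X₁X₄]E[X₂X₃]`. -/
theorem isserlis_wick_four
    {Ω : Type*} [MeasurableSpace Ω] (P : Measure Ω) [IsProbabilityMeasure P]
    (X₁ X₂ X₃ X₄ : Ω → ℝ)
    (h₁ : Measurable X₁) (h₂ : Measurable X₂) (h₃ : Measurable X₃) (h₄ : Measurable X₄)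
    (hGauss : ∀ c₁ c₂ c₃ c₄ : ℝ, ∃ v : NNReal,
      Measure.map (fun ω => c₁ * X₁ ω + c₂ * X₂ ω + c₃ * X₃ ω + c₄ * X₄ ω) P =
        gaussianReal 0 v) :
    (∫ ω, (X₁ ω * X₂ ω) * (X₃ ω * X₄ ω) ∂P) -
        (∫ ω, X₁ ω * X₂ ω ∂P) * (∫ ω, X₃ ω * X₄ ω ∂P) =
      (∫ ω, X₁ ω * X₃ ω ∂P) * (∫ ω, X₂ ω * X₄ ω ∂P) +
        (∫ ω, X₁ ω * X₄ ω ∂P) * (∫ ω, X₂ ω * X₃ ω ∂P) := by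
  have hY : ∀ c₁ c₂ c₃ c₄ : ℝ,
      Measurable fun ω => c₁ * X₁ ω + c₂ * X₂ ω + c₃ * X₃ ω + c₄ * X₄ ω := by
    intros
    fun_prop
  have hLp : ∀ c₁ c₂ c₃ c₄ : ℝ, ∀ p : NNReal,
      MemLp (fun ω => c₁ * X₁ ω + c₂ * X₂ ω + c₃ * X₃ ω + c₄ * X₄ ω) p P := by
    intro c₁ c₂ c₃ c₄ p
    obtain ⟨v, hv⟩ := hGauss c₁ c₂ c₃ c₄
    exact memLp_of_map_eq_gaussianReal (hY c₁ c₂ c₃ c₄) hv p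
  have hint : ∀ c₁ c₂ c₃ c₄ : ℝ,
      Integrable (fun ω => (c₁ * X₁ ω + c₂ * X₂ ω + c₃ * X₃ ω + c₄ * X₄ ω) ^ 4) P := by
    intro c₁ c₂ c₃ c₄
    have := (hLp c₁ c₂ c₃ c₄ 4).integrable_norm_pow (p := 4) (by norm_num)
    simpa [Even.pow_abs (by decide : Even 4)] using this
  have hX : ∀ i, MemLp (![X₁, X₂, X₃, X₄] i) 2 P := by
    intro i
    fin_cases i
    · simpa using hLp 1 0 0 0 2
    · simpa using hLp 0 1 0 0 2
    · simpa using hLp 0 0 1 0 2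
    · simpa using hLp 0 0 0 1 2
  have hfour : ∀ c₁ c₂ c₃ c₄ : ℝ,
      ∫ ω, (c₁ * X₁ ω + c₂ * X₂ ω + c₃ * X₃ ω + c₄ * X₄ ω) ^ 4 ∂P =
        3 * (∑ i, ∑ j, ![c₁, c₂, c₃, c₄] i * ![c₁, c₂, c₃, c₄] j *
          ∫ ω, ![X₁, X₂, X₃, X₄] i ω * ![X₁, X₂, X₃, X₄] j ω ∂P) ^ 2 := by
    intro c₁ c₂ c₃ c₄
    obtain ⟨v, hv⟩ := hGauss c₁ c₂ c₃ c₄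
    rw [integral_pow_four_eq_of_map_eq_gaussianReal (hY c₁ c₂ c₃ c₄) hv,
      ← integral_sq_sum_mul hX]
    simp [Fin.sum_univ_four]
  have hsymm : ∀ Y Z : Ω → ℝ, ∫ ω, Y ω * Z ω ∂P = ∫ ω, Z ω * Y ω ∂P := fun Y Z => by
    simp_rw [mul_comm]
  have hterm : ∀ a b c : ℝ, Integrable
      (fun ω => a * b * c * (1 * X₁ ω + a * X₂ ω + b * X₃ ω + c * X₄ ω) ^ 4) P :=
    fun a b c => (hint 1 a b c).const_mul _
  have hprod : ∫ ω, (X₁ ω * X₂ ω) * (X₃ ω * X₄ ω) ∂P =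
      (1 / 192) * ∑ a ∈ ({1, -1} : Finset ℝ), ∑ b ∈ ({1, -1} : Finset ℝ),
        ∑ c ∈ ({1, -1} : Finset ℝ), a * b * c *
          ∫ ω, (1 * X₁ ω + a * X₂ ω + b * X₃ ω + c * X₄ ω) ^ 4 ∂P := by
    simp_rw [mul_four_eq_sum_signs]
    rw [integral_const_mul, integral_finsetSum _ fun a _ => integrable_finsetSum _ fun b _ =>
      integrable_finsetSum _ fun c _ => hterm a b c]
    congr 1
    refine Finset.sum_congr rfl fun a _ => ?_
    rw [integral_finsetSum _ fun b _ => integrable_finsetSum _ fun c _ => hterm a b c]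
    refine Finset.sum_congr rfl fun b _ => ?_
    rw [integral_finsetSum _ fun c _ => hterm a b c]
    exact Finset.sum_congr rfl fun c _ => integral_const_mul _ _
  have hne : (1 : ℝ) ≠ -1 := by norm_num
  rw [hprod]
  simp only [hfour, Finset.sum_pair hne, Fin.sum_univ_four, Matrix.cons_val]
  rw [hsymm X₂ X₁, hsymm X₃ X₁, hsymm X₄ X₁, hsymm X₃ X₂, hsymm X₄ X₂, hsymm X₄ X₃]
  ring
end

section
/- Let E be a complete normed vector space (Banach space) and let (a_n) and (b_n) be sequences in E. Suppose there exists ℓ ∈ E such that for every strictly monotone function σ : ℕ → ℕ, the sequence n ↦ a_n + b_{σ(n)} converges to ℓ. Then both (a_n) and (b_n) converge. -/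
open Filter Topology

/-- If in a Banach space `a_n + b_{σ(n)} → ℓ` for every strictly monotone `σ : ℕ → ℕ`, with the
same limit `ℓ`, then both `(a_n)` and `(b_n)` converge. -/
theorem converges_of_sum_subsequences_converge
    {E : Type*} [NormedAddCommGroup E] [NormedSpace ℝ E] [CompleteSpace E]
    (a b : ℕ → E) (ℓ : E)
    (h : ∀ σ : ℕ → ℕ, StrictMono σ → Tendsto (fun n => a n + b (σ n)) atTop (𝓝 ℓ)) :
    (∃ la : E, Tendsto a atTop (𝓝 la)) ∧ (∃ lb : E, Tendsto b atTop (𝓝 lb)) := by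
  have hb : CauchySeq b := by
    rw [Metric.cauchySeq_iff]
    by_contra! hcon
    obtain ⟨ε, hε, hcon⟩ := hcon
    choose p hp q hq hpq using hcon
    have hp_top : Tendsto p atTop atTop := tendsto_atTop_mono hp tendsto_id
    have hq_top : Tendsto q atTop atTop := tendsto_atTop_mono hq tendsto_id
    obtain ⟨φ, hφ, hpφ⟩ := strictMono_subseq_of_tendsto_atTop hp_top
    obtain ⟨ψ, hψ, hqψ⟩ := strictMono_subseq_of_tendsto_atTop (hq_top.comp hφ.tendsto_atTop)
    have hlim := (h _ (hpφ.comp hψ)).dist (h _ hqψ)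
    simp only [dist_add_left, dist_self] at hlim
    exact hε.not_ge (ge_of_tendsto' hlim fun n => hpq (φ (ψ n)))
  obtain ⟨lb, hlb⟩ := cauchySeq_tendsto_of_complete hb
  refine ⟨⟨ℓ - lb, ?_⟩, lb, hlb⟩
  simpa using (h id strictMono_id).sub hlb
end

section
/- Let D ⊆ ℝ^d be compact and K a cf-m kernel from D to finite signed Borel measures on D such that K(x,A) ≥ 0 for every x ∈ D and Borel A ⊆ D. If K is self-integrable over D, then there exists a finite (positive) Borel measure ν on D such that for every Borel set A ⊆ D, K is self-integrable over A with self-integral ∫_A K(x,dx) = ν(A). -/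
open MeasureTheory Filter Topology

/-- A finite tagged partition of `A` into Borel pieces of diameter at most `r`, encoded as a finite
set of pairs (piece, tag). -/
structure IsTaggedPartition {α : Type*} [MeasurableSpace α] [PseudoMetricSpace α]
    (A : Set α) (r : ℝ) (P : Finset (Set α × α)) : Prop where
  measurable : ∀ p ∈ P, MeasurableSet p.1
  tag_mem : ∀ p ∈ P, p.2 ∈ p.1
  disj : ∀ p ∈ P, ∀ q ∈ P, p ≠ q → Disjoint p.1 q.1
  cover : (⋃ p ∈ P, p.1) = A
  diam_le : ∀ p ∈ P, Metric.diam p.1 ≤ r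

/-- The Riemann sum of the kernel `K` over a finite set of (piece, tag) pairs. -/
noncomputable def riemannSum {α : Type*} [MeasurableSpace α] (K : α → SignedMeasure α)
    (P : Finset (Set α × α)) : ℝ :=
  ∑ p ∈ P, K p.2 p.1

/-- `ν` assigns to every Borel set the limit of its Riemann sums, uniformly in the set. -/
def IsUniformSelfIntegral {α : Type*} [MeasurableSpace α] [PseudoMetricSpace α]
    (K : α → SignedMeasure α) (ν : Set α → ℝ) : Prop :=
  ∀ ε : ℝ, 0 < ε → ∃ r : ℝ, 0 < r ∧ ∀ A : Set α, MeasurableSet A →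
    ∀ P, IsTaggedPartition A r P → |riemannSum K P - ν A| ≤ ε

section

variable {α : Type*} [MeasurableSpace α]

namespace IsTaggedPartition

variable [PseudoMetricSpace α] {A B : Set α} {r s : ℝ} {P Q : Finset (Set α × α)}

lemma mono (hP : IsTaggedPartition A r P) (h : r ≤ s) : IsTaggedPartition A s P :=
  ⟨hP.measurable, hP.tag_mem, hP.disj, hP.cover, fun p hp => (hP.diam_le p hp).trans h⟩

lemma subset (hP : IsTaggedPartition A r P) {p : Set α × α} (hp : p ∈ P) : p.1 ⊆ A := by
  rw [← hP.cover]
  exact Set.subset_biUnion_of_mem (u := fun p : Set α × α => p.1) hp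

lemma empty (r : ℝ) : IsTaggedPartition (∅ : Set α) r ∅ := by
  constructor <;> simp

lemma singleton (hA : MeasurableSet A) {a : α} (ha : a ∈ A) (hr : Metric.diam A ≤ r) :
    IsTaggedPartition A r {(A, a)} := by
  constructor <;> simp [hA, ha, hr]

lemma disjoint (hP : IsTaggedPartition A r P) (hQ : IsTaggedPartition B s Q)
    (hAB : Disjoint A B) : Disjoint P Q := by
  rw [Finset.disjoint_left]
  intro p hp hq
  exact Set.disjoint_left.1 hAB (hP.subset hp (hP.tag_mem p hp)) (hQ.subset hq (hQ.tag_mem p hq))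

open Classical in
lemma union (hP : IsTaggedPartition A r P) (hQ : IsTaggedPartition B r Q)
    (hAB : Disjoint A B) : IsTaggedPartition (A ∪ B) r (P ∪ Q) where
  measurable p hp := (Finset.mem_union.1 hp).elim (hP.measurable p) (hQ.measurable p)
  tag_mem p hp := (Finset.mem_union.1 hp).elim (hP.tag_mem p) (hQ.tag_mem p)
  disj p hp q hq hpq := by
    rcases Finset.mem_union.1 hp with hp | hp <;> rcases Finset.mem_union.1 hq with hq | hq
    · exact hP.disj p hp q hq hpq
    · exact hAB.mono (hP.subset hp) (hQ.subset hq)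
    · exact hAB.symm.mono (hQ.subset hp) (hP.subset hq)
    · exact hQ.disj p hp q hq hpq
  cover := by rw [Finset.set_biUnion_union, hP.cover, hQ.cover]
  diam_le p hp := (Finset.mem_union.1 hp).elim (hP.diam_le p) (hQ.diam_le p)

open Classical in
lemma riemannSum_union (hP : IsTaggedPartition A r P) (hQ : IsTaggedPartition B s Q)
    (hAB : Disjoint A B) (K : α → SignedMeasure α) :
    riemannSum K (P ∪ Q) = riemannSum K P + riemannSum K Q :=
  Finset.sum_union (hP.disjoint hQ hAB)

/-- In a compact space, all Borel sets have fine tagged partitions of uniformly bounded size. -/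
lemma exists_card_le [CompactSpace α] [OpensMeasurableSpace α] (hr : 0 < r) :
    ∃ N : ℕ, ∀ A : Set α, MeasurableSet A → ∃ P, IsTaggedPartition A r P ∧ P.card ≤ N := by
  classical
  suffices h : ∃ N : ℕ, ∃ U : Set α, MeasurableSet U ∧ Set.univ ⊆ U ∧ ∀ A ⊆ U, MeasurableSet A →
      ∃ P, IsTaggedPartition A r P ∧ P.card ≤ N by
    obtain ⟨N, U, -, hU, h⟩ := h
    exact ⟨N, fun A hA => h A ((Set.subset_univ A).trans hU) hA⟩
  refine isCompact_univ.induction_on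
    (p := fun s => ∃ N : ℕ, ∃ U : Set α, MeasurableSet U ∧ s ⊆ U ∧ ∀ A ⊆ U, MeasurableSet A →
      ∃ P, IsTaggedPartition A r P ∧ P.card ≤ N) ?_ ?_ ?_ ?_
  · refine ⟨0, ∅, .empty, subset_rfl, fun A hA _ => ⟨∅, ?_, le_rfl⟩⟩
    rw [Set.subset_empty_iff.1 hA]
    exact empty r
  · rintro s t hst ⟨N, U, hU, htU, h⟩
    exact ⟨N, U, hU, hst.trans htU, h⟩
  · rintro s t ⟨N, U, hU, hsU, hN⟩ ⟨M, V, hV, htV, hM⟩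
    refine ⟨N + M, U ∪ V, hU.union hV, Set.union_subset_union hsU htV, fun A hAUV hA => ?_⟩
    obtain ⟨P, hP, hPN⟩ := hN (A ∩ U) Set.inter_subset_right (hA.inter hU)
    obtain ⟨Q, hQ, hQM⟩ := hM (A \ U)
      (fun x hx => (hAUV hx.1).resolve_left hx.2) (hA.diff hU)
    refine ⟨P ∪ Q, ?_, (Finset.card_union_le P Q).trans (add_le_add hPN hQM)⟩
    rw [← Set.inter_union_sdiff A U]
    exact hP.union hQ (Set.disjoint_sdiff_inter.symm)
  · intro x _
    refine ⟨Metric.closedBall x (r / 2),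
      mem_nhdsWithin_of_mem_nhds (Metric.closedBall_mem_nhds x (by positivity)),
      1, _, Metric.isClosed_closedBall.measurableSet, subset_rfl, fun A hAx hA => ?_⟩
    rcases A.eq_empty_or_nonempty with rfl | ⟨a, ha⟩
    · exact ⟨∅, empty r, by simp⟩
    · refine ⟨{(A, a)}, singleton hA ha ?_, by simp⟩
      calc Metric.diam A ≤ Metric.diam (Metric.closedBall x (r / 2)) :=
            Metric.diam_mono hAx Metric.isBounded_closedBall
        _ ≤ 2 * (r / 2) := Metric.diam_closedBall (by positivity)
        _ = r := by ring

lemma exists_of_measurableSet [CompactSpace α] [OpensMeasurableSpace α] (hA : MeasurableSet A) (hr : 0 < r) :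
    ∃ P, IsTaggedPartition A r P := by
  obtain ⟨N, hN⟩ := exists_card_le (α := α) hr
  obtain ⟨P, hP, -⟩ := hN A hA
  exact ⟨P, hP⟩

end IsTaggedPartition

namespace RiemannSystem

variable [PseudoMetricSpace α] {A : Set α}

lemma injOn (R : RiemannSystem A) (n : ℕ) :
    Set.InjOn (fun j => (R.piece n j, R.tag n j)) (R.J n) := by
  intro j hj k hk h
  by_contra hjk
  have hp : R.piece n j = R.piece n k := congrArg Prod.fst h
  have := R.disj n j hj k hk hjk
  rw [hp, disjoint_self] at this
  exact (R.nonempty n k hk).ne_empty this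

open Classical in
lemma isTaggedPartition_image (R : RiemannSystem A) {n : ℕ} {r : ℝ}
    (h : ∀ j ∈ R.J n, Metric.diam (R.piece n j) ≤ r) :
    IsTaggedPartition A r ((R.J n).image fun j => (R.piece n j, R.tag n j)) where
  measurable := by simpa using R.measurable n
  tag_mem := by simpa using R.tag_mem n
  disj := by
    intro p hp q hq hpq
    obtain ⟨j, hj, rfl⟩ := Finset.mem_image.1 hp
    obtain ⟨k, hk, rfl⟩ := Finset.mem_image.1 hq
    exact R.disj n j hj k hk fun hjk => hpq (by rw [hjk])
  cover := by rw [Finset.set_biUnion_finset_image]; exact R.cover n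
  diam_le := by simpa using h

open Classical in
lemma riemannSum_image (R : RiemannSystem A) (n : ℕ) (K : α → SignedMeasure α) :
    riemannSum K ((R.J n).image fun j => (R.piece n j, R.tag n j)) =
      ∑ j ∈ R.J n, K (R.tag n j) (R.piece n j) :=
  Finset.sum_image (R.injOn n)

/-- A sequence of tagged partitions with mesh tending to zero gives a Riemann system. -/
lemma exists_of_isTaggedPartition [Nonempty α] {P : ℕ → Finset (Set α × α)} {r : ℕ → ℝ}
    (hP : ∀ n, IsTaggedPartition A (r n) (P n)) (hr : Tendsto r atTop (𝓝 0)) :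
    ∃ R : RiemannSystem A, ∀ (K : α → SignedMeasure α) (n : ℕ),
      ∑ j ∈ R.J n, K (R.tag n j) (R.piece n j) = riemannSum K (P n) := by
  classical
  obtain ⟨a⟩ := ‹Nonempty α›
  have hen (n : ℕ) : ∃ e : ℕ → Set α × α, Set.InjOn e (Finset.range (P n).card) ∧
      (Finset.range (P n).card).image e = P n := by
    refine ⟨fun j => if h : j < (P n).card then (P n).equivFin.symm ⟨j, h⟩ else (∅, a), ?_, ?_⟩
    · intro j hj k hk h
      have hj : j < (P n).card := by simpa using hj
      have hk : k < (P n).card := by simpa using hk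
      simp only [hj, hk, dif_pos] at h
      simpa using (P n).equivFin.symm.injective (Subtype.ext h)
    · ext p
      simp only [Finset.mem_image, Finset.mem_range]
      constructor
      · rintro ⟨j, hj, rfl⟩
        simp [hj]
      · intro hp
        exact ⟨(P n).equivFin ⟨p, hp⟩, Fin.is_lt _, by simp⟩
  choose e he_inj he using hen
  have hmem (n j : ℕ) (hj : j ∈ Finset.range (P n).card) : e n j ∈ P n := by
    rw [← he n]
    exact Finset.mem_image_of_mem _ hj
  refine ⟨⟨fun n => Finset.range (P n).card, fun n j => (e n j).1, fun n j => (e n j).2,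
    fun n j hj => (hP n).measurable _ (hmem n j hj),
    fun n j hj => ⟨_, (hP n).tag_mem _ (hmem n j hj)⟩,
    fun n j hj k hk hjk => (hP n).disj _ (hmem n j hj) _ (hmem n k hk)
      fun h => hjk (he_inj n hj hk h),
    fun n => ?_, fun n j hj => (hP n).tag_mem _ (hmem n j hj), fun ε hε => ?_⟩, fun K n => ?_⟩
  · rw [← (hP n).cover, ← Finset.set_biUnion_finset_image (f := e n) (g := Prod.fst), he n]
  · obtain ⟨N, hN⟩ := eventually_atTop.1 (hr.eventually_le_const hε)
    exact ⟨N, fun n hn j hj => ((hP n).diam_le _ (hmem n j hj)).trans (hN n hn)⟩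
  · conv_rhs => rw [← he n]
    exact (Finset.sum_image (f := fun p : Set α × α => K p.2 p.1) (he_inj n)).symm

end RiemannSystem

section Integrability

variable [PseudoMetricSpace α] {K : α → SignedMeasure α}

/-- Convergence along Riemann systems is uniform in the mesh. -/
lemma exists_mesh_of_tendsto_riemannSystem [Nonempty α] {A : Set α} {l : ℝ}
    (h : ∀ R : RiemannSystem A,
      Tendsto (fun n => ∑ j ∈ R.J n, K (R.tag n j) (R.piece n j)) atTop (𝓝 l))
    {ε : ℝ} (hε : 0 < ε) :
    ∃ r : ℝ, 0 < r ∧ ∀ P, IsTaggedPartition A r P → |riemannSum K P - l| ≤ ε := by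
  by_contra! hcon
  choose P hP hfar using fun n : ℕ => hcon (1 / ((n : ℝ) + 1)) (by positivity)
  obtain ⟨R, hR⟩ := RiemannSystem.exists_of_isTaggedPartition hP
    tendsto_one_div_add_atTop_nhds_zero_nat
  obtain ⟨n, hn⟩ := (Metric.tendsto_nhds.1 (h R) ε hε).exists
  rw [hR, Real.dist_eq] at hn
  exact (hfar n).not_gt hn

/-- Self-integrability over a compact space implies uniform self-integrability over all its Borel
subsets. -/
lemma exists_isUniformSelfIntegral [CompactSpace α] [OpensMeasurableSpace α] {l : ℝ}
    (h : ∀ ε : ℝ, 0 < ε → ∃ r : ℝ, 0 < r ∧ ∀ P, IsTaggedPartition (Set.univ : Set α) r P →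
      |riemannSum K P - l| ≤ ε) :
    ∃ ν : Set α → ℝ, IsUniformSelfIntegral K ν := by
  classical
  have hcauchy (ε : ℝ) (hε : 0 < ε) : ∃ r : ℝ, 0 < r ∧ ∀ A : Set α, MeasurableSet A →
      ∀ P Q, IsTaggedPartition A r P → IsTaggedPartition A r Q →
        |riemannSum K P - riemannSum K Q| ≤ ε := by
    obtain ⟨r, hr, hl⟩ := h (ε / 2) (by positivity)
    refine ⟨r, hr, fun A hA P Q hP hQ => ?_⟩
    obtain ⟨T, hT⟩ := IsTaggedPartition.exists_of_measurableSet hA.compl hr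
    have hd : Disjoint A Aᶜ := disjoint_compl_right
    have h1 := hP.union hT hd
    have h2 := hQ.union hT hd
    rw [Set.union_compl_self] at h1 h2
    have h1 := hl _ h1
    have h2 := hl _ h2
    rw [hP.riemannSum_union hT hd] at h1
    rw [hQ.riemannSum_union hT hd] at h2
    rw [abs_le] at *
    constructor <;> linarith [h1.1, h1.2, h2.1, h2.2]
  have hlim (A : Set α) : ∃ L : ℝ, MeasurableSet A → ∃ P : ℕ → Finset (Set α × α),
      (∀ n : ℕ, IsTaggedPartition A (1 / ((n : ℝ) + 1)) (P n)) ∧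
        Tendsto (fun n => riemannSum K (P n)) atTop (𝓝 L) := by
    by_cases hA : MeasurableSet A
    swap
    · exact ⟨0, fun h => absurd h hA⟩
    choose P hP using fun n : ℕ => IsTaggedPartition.exists_of_measurableSet hA
      (r := 1 / ((n : ℝ) + 1)) (by positivity)
    have hseq : CauchySeq fun n => riemannSum K (P n) := by
      rw [Metric.cauchySeq_iff']
      intro ε hε
      obtain ⟨r, hr, hc⟩ := hcauchy (ε / 2) (by positivity)
      obtain ⟨N, hN⟩ := eventually_atTop.1
        (tendsto_one_div_add_atTop_nhds_zero_nat (𝕜 := ℝ) |>.eventually_le_const hr)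
      refine ⟨N, fun n hn => ?_⟩
      rw [Real.dist_eq]
      exact (hc A hA _ _ ((hP n).mono (hN n hn)) ((hP N).mono (hN N le_rfl))).trans_lt
        (half_lt_self hε)
    obtain ⟨L, hL⟩ := cauchySeq_tendsto_of_complete hseq
    exact ⟨L, fun _ => ⟨P, hP, hL⟩⟩
  choose ν hν using hlim
  refine ⟨ν, fun ε hε => ?_⟩
  obtain ⟨r, hr, hc⟩ := hcauchy ε hε
  refine ⟨r, hr, fun A hA P hP => ?_⟩
  obtain ⟨Q, hQ, hQν⟩ := hν A hA
  refine le_of_tendsto (hQν.const_sub (riemannSum K P)).abs ?_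
  filter_upwards [tendsto_one_div_add_atTop_nhds_zero_nat (𝕜 := ℝ) |>.eventually_le_const hr]
    with n hn
  exact hc A hA P _ hP ((hQ n).mono hn)

namespace IsUniformSelfIntegral

variable {ν : Set α → ℝ}

lemma tendsto (hν : IsUniformSelfIntegral K ν) {A : Set α} (hA : MeasurableSet A)
    (R : RiemannSystem A) :
    Tendsto (fun n => ∑ j ∈ R.J n, K (R.tag n j) (R.piece n j)) atTop (𝓝 (ν A)) := by
  classical
  rw [Metric.tendsto_atTop]
  intro ε hε
  obtain ⟨r, hr, h⟩ := hν (ε / 2) (by positivity)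
  obtain ⟨N, hN⟩ := R.diam_small r hr
  refine ⟨N, fun n hn => ?_⟩
  rw [← R.riemannSum_image, Real.dist_eq]
  exact (h A hA _ (R.isTaggedPartition_image (hN n hn))).trans_lt (half_lt_self hε)

variable [CompactSpace α] [OpensMeasurableSpace α]

lemma nonneg (hν : IsUniformSelfIntegral K ν)
    (hpos : ∀ (x : α) (A : Set α), MeasurableSet A → 0 ≤ K x A) {A : Set α}
    (hA : MeasurableSet A) : 0 ≤ ν A := by
  refine le_of_forall_pos_le_add fun ε hε => ?_
  obtain ⟨r, hr, h⟩ := hν ε hε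
  obtain ⟨P, hP⟩ := IsTaggedPartition.exists_of_measurableSet hA hr
  have h0 : 0 ≤ riemannSum K P := Finset.sum_nonneg fun p hp => hpos _ _ (hP.measurable p hp)
  linarith [(abs_le.1 (h A hA P hP)).2]

lemma union (hν : IsUniformSelfIntegral K ν) {A B : Set α} (hA : MeasurableSet A)
    (hB : MeasurableSet B) (hAB : Disjoint A B) : ν (A ∪ B) = ν A + ν B := by
  classical
  refine eq_of_forall_dist_le fun ε hε => ?_
  obtain ⟨r, hr, h⟩ := hν (ε / 3) (by positivity)
  obtain ⟨P, hP⟩ := IsTaggedPartition.exists_of_measurableSet hA hr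
  obtain ⟨Q, hQ⟩ := IsTaggedPartition.exists_of_measurableSet hB hr
  have h1 := abs_le.1 (h A hA P hP)
  have h2 := abs_le.1 (h B hB Q hQ)
  have h3 := abs_le.1 (h _ (hA.union hB) _ (hP.union hQ hAB))
  rw [hP.riemannSum_union hQ hAB] at h3
  rw [Real.dist_eq, abs_le]
  constructor <;> linarith [h1.1, h1.2, h2.1, h2.2, h3.1, h3.2]

lemma empty (hν : IsUniformSelfIntegral K ν) : ν ∅ = 0 := by
  simpa using hν.union MeasurableSet.empty MeasurableSet.empty (Set.disjoint_empty _)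

/-- The self-integral is continuous from above at the empty set. -/
lemma tendsto_zero (hν : IsUniformSelfIntegral K ν)
    (hcont : ∀ A : Set α, MeasurableSet A → Continuous fun x : α => K x A)
    (hpos : ∀ (x : α) (A : Set α), MeasurableSet A → 0 ≤ K x A)
    {A : ℕ → Set α} (hA : ∀ n, MeasurableSet (A n)) (hanti : Antitone A)
    (hinter : ⋂ n, A n = ∅) : Tendsto (fun n => ν (A n)) atTop (𝓝 0) := by
  have hmono {B C : Set α} (hB : MeasurableSet B) (hC : MeasurableSet C) (hBC : B ⊆ C) (x : α) :
      K x B ≤ K x C := by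
    rw [← VectorMeasure.of_add_of_sdiff hB hC hBC]
    exact le_add_of_nonneg_right (hpos x _ (hC.diff hB))
  have hunif : TendstoUniformly (fun n x => K x (A n)) (fun _ => 0) atTop := by
    refine Antitone.tendstoUniformly_of_forall_tendsto (fun n => hcont _ (hA n))
      (fun m n hmn x => hmono (hA n) (hA m) (hanti hmn) x) continuous_const fun x => ?_
    have := VectorMeasure.tendsto_vectorMeasure_iInter_atTop_nat (v := K x) hanti hA
    rwa [hinter, VectorMeasure.empty] at this
  rw [Metric.tendsto_atTop]
  intro ε hε
  obtain ⟨r, hr, h⟩ := hν (ε / 3) (by positivity)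
  obtain ⟨N, hN⟩ := IsTaggedPartition.exists_card_le (α := α) hr
  have hη : 0 < ε / 3 / ((N : ℝ) + 1) := by positivity
  obtain ⟨n₀, hn₀⟩ := eventually_atTop.1 (Metric.tendstoUniformly_iff.1 hunif _ hη)
  refine ⟨n₀, fun n hn => ?_⟩
  obtain ⟨P, hP, hcard⟩ := hN (A n) (hA n)
  have hsum : riemannSum K P ≤ ε / 3 :=
    calc riemannSum K P ≤ P.card • (ε / 3 / ((N : ℝ) + 1)) := by
          refine Finset.sum_le_card_nsmul _ _ _ fun p hp => ?_
          refine (hmono (hP.measurable p hp) (hA n) (hP.subset hp) p.2).trans ?_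
          have := hn₀ n hn p.2
          rw [Real.dist_eq, zero_sub, abs_neg] at this
          exact (le_abs_self _).trans this.le
      _ ≤ ((N : ℝ) + 1) * (ε / 3 / ((N : ℝ) + 1)) := by
          rw [nsmul_eq_mul]
          have : (P.card : ℝ) ≤ N := by exact_mod_cast hcard
          gcongr
          linarith
      _ = ε / 3 := by field_simp
  rw [Real.dist_eq, sub_zero, abs_of_nonneg (hν.nonneg hpos (hA n))]
  linarith [(abs_le.1 (h (A n) (hA n) P hP)).1]

lemma hasSum (hν : IsUniformSelfIntegral K ν)
    (hcont : ∀ A : Set α, MeasurableSet A → Continuous fun x : α => K x A)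
    (hpos : ∀ (x : α) (A : Set α), MeasurableSet A → 0 ≤ K x A)
    {f : ℕ → Set α} (hf : ∀ i, MeasurableSet (f i)) (hd : Pairwise (Function.onFun Disjoint f)) :
    HasSum (fun i => ν (f i)) (ν (⋃ i, f i)) := by
  rw [hasSum_iff_tendsto_nat_of_nonneg fun i => hν.nonneg hpos (hf i)]
  let T (n : ℕ) : Set α := ⋃ i ≥ n, f i
  have hT (n : ℕ) : MeasurableSet (T n) := .iUnion fun i => .iUnion fun _ => hf i
  have hanti : Antitone T := fun m n hmn =>
    Set.biUnion_subset_biUnion_left fun i (hi : n ≤ i) => hmn.trans hi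
  have hmem {x : α} {n : ℕ} : x ∈ T n ↔ ∃ i, n ≤ i ∧ x ∈ f i := by simp [T]
  have huniq {x : α} {i j : ℕ} (hi : x ∈ f i) (hj : x ∈ f j) : i = j := by
    by_contra hij
    exact Set.disjoint_left.1 (hd hij) hi hj
  have hinter : ⋂ n, T n = ∅ := by
    refine Set.eq_empty_of_forall_notMem fun x hx => ?_
    have hx := fun n => hmem.1 (Set.mem_iInter.1 hx n)
    obtain ⟨i, -, hi⟩ := hx 0
    obtain ⟨j, hij, hj⟩ := hx (i + 1)
    have := huniq hi hj
    omega
  have hstep (n : ℕ) : ν (T n) = ν (f n) + ν (T (n + 1)) := by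
    rw [← hν.union (hf n) (hT (n + 1))]
    · congr 1
      ext x
      rw [Set.mem_union, hmem, hmem]
      constructor
      · rintro ⟨i, hi, hxi⟩
        rcases hi.eq_or_lt with rfl | hi
        · exact .inl hxi
        · exact .inr ⟨i, hi, hxi⟩
      · rintro (hx | ⟨i, hi, hxi⟩)
        · exact ⟨n, le_rfl, hx⟩
        · exact ⟨i, by omega, hxi⟩
    · refine Set.disjoint_left.2 fun x hx hx' => ?_
      obtain ⟨i, hi, hxi⟩ := hmem.1 hx'
      have := huniq hx hxi
      omega
  have hsum (n : ℕ) : ∑ i ∈ Finset.range n, ν (f i) = ν (⋃ i, f i) - ν (T n) := by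
    induction n with
    | zero => simp [T]
    | succ n ih => rw [Finset.sum_range_succ, ih, hstep n]; ring
  simp_rw [hsum]
  simpa using (hν.tendsto_zero hcont hpos hT hanti hinter).const_sub (ν (⋃ i, f i))

/-- A uniform self-integral of a nonnegative kernel with continuous evaluations is given by a
finite measure. -/
lemma exists_measure (hν : IsUniformSelfIntegral K ν)
    (hcont : ∀ A : Set α, MeasurableSet A → Continuous fun x : α => K x A)
    (hpos : ∀ (x : α) (A : Set α), MeasurableSet A → 0 ≤ K x A) :
    ∃ μ : Measure α, IsFiniteMeasure μ ∧ ∀ A, MeasurableSet A → (μ A).toReal = ν A := by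
  let μ : Measure α := Measure.ofMeasurable (fun A _ => ENNReal.ofReal (ν A))
    (by simp [hν.empty]) fun f hf hd => by
      have hs := hν.hasSum hcont hpos hf hd
      rw [← hs.tsum_eq, ENNReal.ofReal_tsum_of_nonneg (fun i => hν.nonneg hpos (hf i)) hs.summable]
  have hμ {A : Set α} (hA : MeasurableSet A) : μ A = ENNReal.ofReal (ν A) :=
    Measure.ofMeasurable_apply A hA
  refine ⟨μ, ⟨?_⟩, fun A hA => ?_⟩
  · rw [hμ .univ]
    exact ENNReal.ofReal_lt_top
  · rw [hμ hA, ENNReal.toReal_ofReal (hν.nonneg hpos hA)]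

end IsUniformSelfIntegral

end Integrability

end

/-- If `K` is a nonnegative cf-m kernel on a compact set `D` which is self-integrable over `D`,
then the self-integrals over Borel subsets of `D` exist and define a finite positive Borel
measure `ν` on `D`. -/
theorem selfIntegral_of_nonneg_kernel_is_measure
    {d : ℕ} (D : Set (EuclideanSpace ℝ (Fin d))) (hD : IsCompact D)
    (K : D → SignedMeasure D)
    (hcont : ∀ A : Set D, MeasurableSet A → Continuous fun x : D => K x A)
    (hpos : ∀ (x : D) (A : Set D), MeasurableSet A → 0 ≤ K x A)
    (hself : ∃ ℓ : ℝ, ∀ R : RiemannSystem (Set.univ : Set D),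
      Tendsto (fun n => ∑ j ∈ R.J n, K (R.tag n j) (R.piece n j)) atTop (𝓝 ℓ)) :
    ∃ ν : Measure D, IsFiniteMeasure ν ∧
      ∀ A : Set D, MeasurableSet A →
        ∀ R : RiemannSystem A,
          Tendsto (fun n => ∑ j ∈ R.J n, K (R.tag n j) (R.piece n j)) atTop
            (𝓝 (ν A).toReal) := by
  have : CompactSpace D := isCompact_iff_compactSpace.1 hD
  rcases isEmpty_or_nonempty D with hempty | _
  · exact ⟨0, inferInstance, fun A _ R => hempty.elim (R.tag 0 0)⟩
  obtain ⟨l, hl⟩ := hself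
  obtain ⟨ν, hν⟩ := exists_isUniformSelfIntegral fun ε hε =>
    exists_mesh_of_tendsto_riemannSystem hl hε
  obtain ⟨μ, hfin, hμ⟩ := hν.exists_measure hcont hpos
  refine ⟨μ, hfin, fun A hA R => ?_⟩
  rw [hμ A hA]
  exact hν.tendsto hA R
end
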